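/- Fix θ, σ > 0, x ∈ (0,π), and 0 < c < d. Let u : [c,d] → (Ω → ℝ) be a centered Gaussian process with covariance E[u(s)u(t)] = (σ²/(θπ)) Σ_{k=1}^∞ k^{−2} sin²(kx) ( e^{−θk²|t−s|} − e^{−θk²(t+s)} ), set t_i := c + (d−c)i/n, and define θ̂_{n,x} := 3(d−c)σ⁴ / ( π Σ_{i=1}^n ( u(t_i) − u(t_{i−1}) )⁴ ). Then there exists V > 0 such that the laws of √n (θ̂_{n,x} − θ) converge weakly, as n → ∞, to the centered Gaussian measure on ℝ with variance V. -/

import Mathlib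

open MeasureTheory ProbabilityTheory Real Filter

noncomputable section

/-- `u` is a centered Gaussian process on `S` with covariance function `C`:
every finite linear combination of its values at points of `S` is a centered real
Gaussian with the corresponding variance. -/
def IsCenteredGaussianField {Ω : Type*} [MeasurableSpace Ω] (P : Measure Ω)
    (u : ℝ → Ω → ℝ) (S : Set ℝ) (C : ℝ → ℝ → ℝ) : Prop :=
  ∀ (n : ℕ) (x : Fin n → ℝ), (∀ i, x i ∈ S) → ∀ a : Fin n → ℝ,
    Measure.map (fun ω => ∑ i, a i * u (x i) ω) P
      = gaussianReal 0 (∑ i, ∑ j, a i * a j * C (x i) (x j)).toNNReal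

/-- Temporal covariance, at a fixed spatial point `x`, of the solution of the stochastic
heat equation `du − θΔu dt = σ dW` on `[0, π]` with zero initial and Dirichlet boundary
conditions:
`E[u(s)u(t)] = (σ²/(θπ)) Σ_{k≥1} k^{−2} sin²(kx)(e^{−θk²|t−s|} − e^{−θk²(t+s)})`. -/
def heatCovTime (θ σ x s t : ℝ) : ℝ :=
  (σ ^ 2 / (θ * π)) * ∑' k : ℕ,
    Real.sin (((k : ℝ) + 1) * x) ^ 2 / ((k : ℝ) + 1) ^ 2 *
      (Real.exp (-(θ * ((k : ℝ) + 1) ^ 2 * |t - s|)) -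
        Real.exp (-(θ * ((k : ℝ) + 1) ^ 2 * (t + s))))

open scoped NNReal ENNReal Topology

/-- One-dimensional Gaussian integration by parts (Stein's identity). -/
lemma integral_smul_gaussianReal_eq {E : Type*} [NormedAddCommGroup E] [NormedSpace ℝ E]
    {v : ℝ≥0} (hv : v ≠ 0) {h h' : ℝ → E} (hd : ∀ x, HasDerivAt h (h' x) x)
    (hi : Integrable h (gaussianReal 0 v)) (hi' : Integrable h' (gaussianReal 0 v))
    (hix : Integrable (fun x => x • h x) (gaussianReal 0 v)) :
    ∫ x, x • h x ∂(gaussianReal 0 v) = (v : ℝ) • ∫ x, h' x ∂(gaussianReal 0 v) := by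
  have hv' : (v : ℝ) ≠ 0 := by exact_mod_cast hv
  have conv : ∀ k : ℝ → E, Integrable k (gaussianReal 0 v) →
      Integrable (fun x => gaussianPDFReal 0 v x • k x) := by
    intro k hk
    rw [gaussianReal_of_var_ne_zero _ hv] at hk
    rw [integrable_withDensity_iff_integrable_smul₀' (by fun_prop)
      (ae_of_all _ fun x => by simp [gaussianPDF])] at hk
    simpa [toReal_gaussianPDF] using hk
  have hpdf : ∀ x, HasDerivAt (gaussianPDFReal 0 v) (-(x / v) * gaussianPDFReal 0 v x) x := by
    intro x
    have h1 : HasDerivAt (fun x : ℝ => -(x - 0) ^ 2 / (2 * (v : ℝ))) (-(x / v)) x := by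
      have := (((hasDerivAt_id x).sub_const 0).pow 2).neg.div_const (2 * (v : ℝ))
      refine this.congr_deriv ?_
      simp only [id]
      field_simp
      ring
    have := (h1.exp).const_mul ((√(2 * π * v))⁻¹)
    rw [gaussianPDFReal_def]
    refine this.congr_deriv ?_
    ring
  have key := integral_bilinear_hasDerivAt_right_eq_neg_left_of_integrable
    (L := ContinuousLinearMap.lsmul ℝ ℝ) (u := gaussianPDFReal 0 v) (v := h) (v' := h')
    (u' := fun x => -(x / v) * gaussianPDFReal 0 v x)
    (fun x _ => hpdf x) (fun x _ => hd x)
    (by simpa using conv h' hi')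
    (by
      have := (conv _ hix).smul (-(v : ℝ)⁻¹)
      refine this.congr (ae_of_all _ fun x => ?_)
      simp only [Pi.smul_apply, smul_smul, ContinuousLinearMap.lsmul_apply]
      congr 1
      field_simp)
    (by simpa using conv h hi)
  rw [integral_gaussianReal_eq_integral_smul hv, integral_gaussianReal_eq_integral_smul hv]
  simp only [ContinuousLinearMap.lsmul_apply] at key
  rw [key, smul_neg, ← integral_smul, ← integral_neg]
  congr 1
  ext x
  simp only [smul_smul, ← neg_smul]
  congr 1
  field_simp

/-- Gaussian integration by parts for a finite centered Gaussian family, in terms of the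
derivative `g'` of `g` in the direction of the covariances with `X i₀`. -/
lemma ProbabilityTheory.HasGaussianLaw.integral_smul_comp_eq {Ω ι E : Type*} [MeasurableSpace Ω] [Fintype ι]
    [NormedAddCommGroup E] [NormedSpace ℝ E]
    [SecondCountableTopology E]
    {P : Measure Ω} [IsProbabilityMeasure P] {X : ι → Ω → ℝ}
    (hX : HasGaussianLaw (fun ω i => X i ω) P) (h0 : ∀ i, ∫ ω, X i ω ∂P = 0)
    (i₀ : ι) {C : ι → ℝ} (hC : ∀ j, ∫ ω, X i₀ ω * X j ω ∂P = C j)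
    {g g' : (ι → ℝ) → E} (hg : ∀ x, HasDerivAt (fun t : ℝ => g (x + t • C)) (g' x) 0)
    (hgc : Continuous g) (hgc' : Continuous g')
    (hi : Integrable (fun ω => g (fun i => X i ω)) P)
    (hi' : Integrable (fun ω => g' (fun i => X i ω)) P)
    (hix : Integrable (fun ω => X i₀ ω • g (fun i => X i ω)) P) :
    ∫ ω, X i₀ ω • g (fun i => X i ω) ∂P = ∫ ω, g' (fun i => X i ω) ∂P := by
  have hmem : ∀ i, MemLp (X i) 2 P := fun i => (hX.eval i).memLp_two
  have hcov : ∀ i j, cov[X i, X j; P] = ∫ ω, X i ω * X j ω ∂P := by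
    intro i j
    rw [covariance_eq_sub (hmem i) (hmem j)]
    simp [h0]
  have hvar : Var[X i₀; P] = C i₀ := by
    rw [← covariance_self (hmem i₀).aestronglyMeasurable.aemeasurable, hcov, hC]
  have hv0 : 0 ≤ C i₀ := hvar ▸ variance_nonneg _ _
  rcases hv0.eq_or_lt with hz | hpos
  · have hX0 : X i₀ =ᵐ[P] 0 := by
      have := ae_eq_integral_of_variance_eq_zero (hmem i₀) (hvar.trans hz.symm)
      filter_upwards [this] with ω hω
      simpa [h0] using hω
    have hC0 : C = 0 := by
      ext j
      rw [← hC j]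
      have : (fun ω => X i₀ ω * X j ω) =ᵐ[P] fun _ => 0 := by
        filter_upwards [hX0] with ω hω
        simp [hω]
      rw [integral_congr_ae this]
      simp
    have hg0 : ∀ x, g' x = 0 := by
      intro x
      have := hg x
      simp only [hC0, smul_zero, add_zero] at this
      exact this.unique (hasDerivAt_const _ _)
    rw [integral_congr_ae (g := fun _ => (0 : E))]
    · simp [hg0]
    · filter_upwards [hX0] with ω hω
      simp [hω]
  · set v : ℝ≥0 := (C i₀).toNNReal with hvdef
    have hvC : (v : ℝ) = C i₀ := Real.coe_toNNReal _ hv0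
    have hv : v ≠ 0 := by
      intro h
      rw [h] at hvC
      simp at hvC
      linarith
    have hlaw : P.map (X i₀) = gaussianReal 0 v := by
      rw [(hX.eval i₀).map_eq_gaussianReal, h0, hvar]
    let Y : ι → Ω → ℝ := fun j ω => X j ω - C j / C i₀ * X i₀ ω
    have hjoint : HasGaussianLaw (fun ω => ((fun _ : Unit => X i₀ ω), (fun j => Y j ω))) P := by
      let L : (ι → ℝ) →L[ℝ] ((Unit → ℝ) × (ι → ℝ)) :=
        (ContinuousLinearMap.pi fun _ => ContinuousLinearMap.proj i₀).prod
          (ContinuousLinearMap.pi fun j =>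
            ContinuousLinearMap.proj j - (C j / C i₀) • ContinuousLinearMap.proj i₀)
      exact hX.map_fun L
    have hind' : IndepFun (fun ω (_ : Unit) => X i₀ ω) (fun ω j => Y j ω) P := by
      refine HasGaussianLaw.indepFun_of_covariance_eval (X := fun _ : Unit => X i₀) hjoint ?_
      intro _ j
      have : Y j = X j - fun ω => C j / C i₀ * X i₀ ω := rfl
      rw [this, covariance_sub_right (hmem _) (hmem _) ((hmem _).const_mul _),
        covariance_const_mul_right, hcov, hcov, hC, hC]
      field_simp
      ring
    have hind : IndepFun (X i₀) (fun ω j => Y j ω) P :=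
      hind'.comp (φ := fun f : Unit → ℝ => f ()) (ψ := id) (by fun_prop) measurable_id
    have hXm : AEMeasurable (X i₀) P := (hX.eval i₀).aemeasurable
    have hYm : AEMeasurable (fun ω j => Y j ω) P := hjoint.snd.aemeasurable
    set μY := P.map (fun ω j => Y j ω) with hμY
    have hprod : P.map (fun ω => (X i₀ ω, fun j => Y j ω)) = (gaussianReal 0 v).prod μY := by
      rw [(indepFun_iff_map_prod_eq_prod_map_map hXm hYm).1 hind, hlaw]
    have : IsProbabilityMeasure μY := Measure.isProbabilityMeasure_map hYm
    let T : ℝ × (ι → ℝ) → (ι → ℝ) := fun p => p.2 + (p.1 / C i₀) • C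
    have hTc : Continuous T := by fun_prop
    have hT : ∀ ω, T (X i₀ ω, fun j => Y j ω) = fun i => X i ω := by
      intro ω
      ext j
      simp only [T, Y, Pi.add_apply, Pi.smul_apply, smul_eq_mul]
      ring
    have hpm : AEMeasurable (fun ω => (X i₀ ω, fun j => Y j ω)) P := hXm.prodMk hYm
    have trI : ∀ k : ℝ × (ι → ℝ) → E, Continuous k →
        ∫ ω, k (X i₀ ω, fun j => Y j ω) ∂P = ∫ p, k p ∂((gaussianReal 0 v).prod μY) := by
      intro k hk
      rw [← hprod, integral_map hpm (hk.aestronglyMeasurable)]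
    have trInt : ∀ k : ℝ × (ι → ℝ) → E, Continuous k →
        Integrable (fun ω => k (X i₀ ω, fun j => Y j ω)) P →
        Integrable k ((gaussianReal 0 v).prod μY) := by
      intro k hk hi
      rw [← hprod]
      exact (integrable_map_measure hk.aestronglyMeasurable hpm).2 hi
    have i1 := trInt (fun p => g (T p)) (by fun_prop) (by simpa only [hT] using hi)
    have i2 := trInt (fun p => g' (T p)) (by fun_prop) (by simpa only [hT] using hi')
    have i3 := trInt (fun p => p.1 • g (T p)) (by fun_prop) (by simpa only [hT] using hix)
    have e1 := trI (fun p => g' (T p)) (by fun_prop)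
    have e2 := trI (fun p => p.1 • g (T p)) (by fun_prop)
    simp only [hT] at e1 e2
    rw [e1, e2, integral_prod_symm _ i3, integral_prod_symm _ i2]
    refine integral_congr_ae ?_
    filter_upwards [i1.prod_left_ae, i2.prod_left_ae, i3.prod_left_ae] with y h1 h2 h3
    have hder : ∀ x : ℝ, HasDerivAt (fun x => g (T (x, y))) ((C i₀)⁻¹ • g' (T (x, y))) x := by
      intro x
      have hb := hg (T (x, y))
      have hs : HasDerivAt (fun z : ℝ => (z - x) / C i₀) ((C i₀)⁻¹) x := by
        have := ((hasDerivAt_id x).sub_const x).div_const (C i₀)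
        simpa using this
      have hb' : HasDerivAt (fun t : ℝ => g (T (x, y) + t • C)) (g' (T (x, y)))
          ((x - x) / C i₀) := by simpa using hb
      have := HasDerivAt.scomp x hb' hs
      convert this using 1
      ext z
      simp only [Function.comp, T]
      congr 1
      ext j
      simp only [Pi.add_apply, Pi.smul_apply, smul_eq_mul]
      ring
    have := integral_smul_gaussianReal_eq hv hder h1 (h2.smul _) h3
    rw [this, integral_smul, hvC, smul_smul, mul_inv_cancel₀ hpos.ne', one_smul]

/-- A real random variable all of whose moments are finite. -/
def HasFiniteMoments {Ω : Type*} [MeasurableSpace Ω] (f : Ω → ℝ) (P : Measure Ω) : Prop :=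
  ∀ p : ℝ≥0∞, p ≠ ∞ → MemLp f p P

namespace HasFiniteMoments

variable {Ω : Type*} [MeasurableSpace Ω] {P : Measure Ω} {f g : Ω → ℝ}

lemma integrable (hf : HasFiniteMoments f P) : Integrable f P :=
  memLp_one_iff_integrable.1 (hf 1 (by simp))

lemma mul (hf : HasFiniteMoments f P) (hg : HasFiniteMoments g P) :
    HasFiniteMoments (fun ω => f ω * g ω) P := by
  intro p hp
  have h2 : (2 * p) ≠ ∞ := ENNReal.mul_ne_top (by simp) hp
  have : ENNReal.HolderTriple (2 * p) (2 * p) p := by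
    constructor
    rw [ENNReal.mul_inv (by simp) (by simp), ← add_mul, ENNReal.inv_two_add_inv_two, one_mul]
  exact MemLp.mul (hg _ h2) (hf _ h2)

lemma add (hf : HasFiniteMoments f P) (hg : HasFiniteMoments g P) :
    HasFiniteMoments (fun ω => f ω + g ω) P := fun p hp => (hf p hp).add (hg p hp)

lemma const_mul (hf : HasFiniteMoments f P) (c : ℝ) :
    HasFiniteMoments (fun ω => c * f ω) P := fun p hp => (hf p hp).const_mul c

lemma const [IsFiniteMeasure P] (c : ℝ) : HasFiniteMoments (fun _ : Ω => c) P :=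
  fun _ _ => memLp_const c

lemma pow [IsFiniteMeasure P] (hf : HasFiniteMoments f P) (n : ℕ) :
    HasFiniteMoments (fun ω => f ω ^ n) P := by
  induction n with
  | zero => simpa using const 1
  | succ n ih => simpa [pow_succ] using ih.mul hf

lemma sum {ι : Type*} (s : Finset ι) {f : ι → Ω → ℝ} (hf : ∀ i, HasFiniteMoments (f i) P) :
    HasFiniteMoments (fun ω => ∑ i ∈ s, f i ω) P :=
  fun p hp => memLp_finsetSum s fun i _ => hf i p hp

end HasFiniteMoments

/-- `X` is a centered jointly Gaussian family with covariance matrix `ρ`. -/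
structure IsCenteredGaussianFamily {Ω ι : Type*} [MeasurableSpace Ω] [Fintype ι] (P : Measure Ω)
    (X : ι → Ω → ℝ) (ρ : ι → ι → ℝ) : Prop where
  gauss : HasGaussianLaw (fun ω i => X i ω) P
  mean : ∀ i, ∫ ω, X i ω ∂P = 0
  cov : ∀ i j, ∫ ω, X i ω * X j ω ∂P = ρ i j

namespace IsCenteredGaussianFamily

variable {Ω ι : Type*} [MeasurableSpace Ω] [Fintype ι] {P : Measure Ω}
  {X : ι → Ω → ℝ} {ρ : ι → ι → ℝ}

lemma moments (h : IsCenteredGaussianFamily P X ρ) (i : ι) : HasFiniteMoments (X i) P :=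
  fun _ hp => (h.gauss.eval i).memLp hp

lemma symm (h : IsCenteredGaussianFamily P X ρ) (i j : ι) : ρ i j = ρ j i := by
  rw [← h.cov, ← h.cov]
  simp only [mul_comm]

lemma nonneg (h : IsCenteredGaussianFamily P X ρ) (i : ι) : 0 ≤ ρ i i := by
  rw [← h.cov]
  exact integral_nonneg fun ω => mul_self_nonneg _

variable [IsProbabilityMeasure P]

lemma map_eq (h : IsCenteredGaussianFamily P X ρ) (i : ι) :
    P.map (X i) = gaussianReal 0 (ρ i i).toNNReal := by
  have hm := h.moments i 2 (by simp)
  rw [(h.gauss.eval i).map_eq_gaussianReal, h.mean, variance_eq_sub hm, h.mean, ← h.cov]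
  simp [pow_two]

lemma moments_monomial (h : IsCenteredGaussianFamily P X ρ) (i j k l : ι) (a b c d : ℕ) :
    HasFiniteMoments (fun ω => X i ω ^ a * X j ω ^ b * X k ω ^ c * X l ω ^ d) P :=
  ((((h.moments i).pow a).mul ((h.moments j).pow b)).mul ((h.moments k).pow c)).mul
    ((h.moments l).pow d)

lemma integral_monomial_succ (h : IsCenteredGaussianFamily P X ρ) (i j k l : ι) (a b c d : ℕ) :
    ∫ ω, X i ω ^ (a + 1) * X j ω ^ b * X k ω ^ c * X l ω ^ d ∂P
      = a * ρ i i * ∫ ω, X i ω ^ (a - 1) * X j ω ^ b * X k ω ^ c * X l ω ^ d ∂P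
      + b * ρ i j * ∫ ω, X i ω ^ a * X j ω ^ (b - 1) * X k ω ^ c * X l ω ^ d ∂P
      + c * ρ i k * ∫ ω, X i ω ^ a * X j ω ^ b * X k ω ^ (c - 1) * X l ω ^ d ∂P
      + d * ρ i l * ∫ ω, X i ω ^ a * X j ω ^ b * X k ω ^ c * X l ω ^ (d - 1) ∂P := by
  have hM := h.moments_monomial i j k l
  have key := h.gauss.integral_smul_comp_eq h.mean i (C := ρ i) (h.cov i)
    (g := fun x => x i ^ a * x j ^ b * x k ^ c * x l ^ d)
    (g' := fun x => a * ρ i i * (x i ^ (a - 1) * x j ^ b * x k ^ c * x l ^ d)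
      + b * ρ i j * (x i ^ a * x j ^ (b - 1) * x k ^ c * x l ^ d)
      + c * ρ i k * (x i ^ a * x j ^ b * x k ^ (c - 1) * x l ^ d)
      + d * ρ i l * (x i ^ a * x j ^ b * x k ^ c * x l ^ (d - 1)))
    (by
      intro x
      have hl : ∀ m : ι, HasDerivAt (fun t : ℝ => (x + t • ρ i) m) (ρ i m) 0 := by
        intro m
        have := ((hasDerivAt_id (0 : ℝ)).mul_const (ρ i m)).const_add (x m)
        simpa using this
      have := ((((hl i).pow a).mul ((hl j).pow b)).mul ((hl k).pow c)).mul ((hl l).pow d)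
      refine this.congr_deriv ?_
      simp
      ring)
    (by fun_prop) (by fun_prop) (hM a b c d).integrable
    (((((hM _ _ _ _).const_mul _).add ((hM _ _ _ _).const_mul _)).add
      ((hM _ _ _ _).const_mul _)).add ((hM _ _ _ _).const_mul _)).integrable
    ((h.moments i).mul (hM a b c d)).integrable
  have e1 : ∫ ω, X i ω ^ (a + 1) * X j ω ^ b * X k ω ^ c * X l ω ^ d ∂P
      = ∫ ω, X i ω • (X i ω ^ a * X j ω ^ b * X k ω ^ c * X l ω ^ d) ∂P := by
    congr 1
    ext ω
    simp only [smul_eq_mul]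
    ring
  rw [e1, key, integral_add, integral_add, integral_add]
  · simp only [integral_const_mul]
  · exact ((hM _ _ _ _).const_mul _).integrable
  · exact ((hM _ _ _ _).const_mul _).integrable
  · exact (((hM _ _ _ _).const_mul _).add ((hM _ _ _ _).const_mul _)).integrable
  · exact ((hM _ _ _ _).const_mul _).integrable
  · exact ((((hM _ _ _ _).const_mul _).add ((hM _ _ _ _).const_mul _)).add
      ((hM _ _ _ _).const_mul _)).integrable
  · exact ((hM _ _ _ _).const_mul _).integrable

lemma integral_pow_bound (h : IsCenteredGaussianFamily P X ρ) {B : ℝ} (i : ι) (hB : ρ i i ≤ B)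
    (N : ℕ) :
    ∫ ω, (1 + |X i ω|) ^ N ∂P ≤ ∫ z, (1 + √B * |z|) ^ N ∂(gaussianReal 0 1) := by
  have hm : gaussianReal 0 (ρ i i).toNNReal = (gaussianReal 0 1).map (√(ρ i i) * ·) := by
    rw [gaussianReal_map_const_mul]
    congr 1
    · simp
    · ext
      simp [Real.sq_sqrt (h.nonneg i), h.nonneg i]
  have hcont : Continuous fun y : ℝ => (1 + |y|) ^ N := by fun_prop
  have hInt : ∀ r : ℝ, Integrable (fun z => (1 + r * |z|) ^ N) (gaussianReal 0 1) := by
    intro r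
    have : HasFiniteMoments (fun z : ℝ => |z|) (gaussianReal 0 1) :=
      fun p hp => (memLp_id_gaussianReal' p hp).norm
    exact (((HasFiniteMoments.const 1).add (this.const_mul r)).pow N).integrable
  have e : ∫ ω, (1 + |X i ω|) ^ N ∂P = ∫ y, (1 + |y|) ^ N ∂(P.map (X i)) := by
    rw [integral_map (h.gauss.eval i).aemeasurable hcont.aestronglyMeasurable]
  rw [e, h.map_eq, hm, integral_map (by fun_prop) hcont.aestronglyMeasurable]
  simp only [abs_mul, abs_of_nonneg (Real.sqrt_nonneg _)]
  refine integral_mono (hInt _) (hInt _) fun z => ?_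
  have := Real.sqrt_le_sqrt hB
  simp only
  gcongr

lemma abs_integral_monomial_le (h : IsCenteredGaussianFamily P X ρ) {B : ℝ}
    (hB : ∀ i, ρ i i ≤ B) (i j k l : ι) (a b c d : ℕ) :
    |∫ ω, X i ω ^ a * X j ω ^ b * X k ω ^ c * X l ω ^ d ∂P|
      ≤ 4 * ∫ z, (1 + √B * |z|) ^ (a + b + c + d) ∂(gaussianReal 0 1) := by
  set N := a + b + c + d with hN
  have hInt : ∀ i, Integrable (fun ω => (1 + |X i ω|) ^ N) P := by
    intro i
    have : HasFiniteMoments (fun ω => |X i ω|) P := fun p hp => (h.moments i p hp).norm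
    exact (((HasFiniteMoments.const 1).add this).pow N).integrable
  have hpt : ∀ x y z w : ℝ, |x ^ a * y ^ b * z ^ c * w ^ d|
      ≤ (1 + |x|) ^ N + (1 + |y|) ^ N + (1 + |z|) ^ N + (1 + |w|) ^ N := by
    intro x y z w
    obtain ⟨m, hm, h1, h2, h3, h4⟩ : ∃ m : ℝ, (m = |x| ∨ m = |y| ∨ m = |z| ∨ m = |w|) ∧
        |x| ≤ m ∧ |y| ≤ m ∧ |z| ≤ m ∧ |w| ≤ m := by
      refine ⟨max (max |x| |y|) (max |z| |w|), ?_, ?_, ?_, ?_, ?_⟩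
      · grind
      all_goals simp
    have hm0 : 0 ≤ m := (abs_nonneg x).trans h1
    have : |x ^ a * y ^ b * z ^ c * w ^ d| ≤ (1 + m) ^ N := by
      rw [abs_mul, abs_mul, abs_mul, abs_pow, abs_pow, abs_pow, abs_pow, hN, pow_add, pow_add,
        pow_add]
      gcongr <;> linarith
    have p1 : 0 ≤ (1 + |x|) ^ N := by positivity
    have p2 : 0 ≤ (1 + |y|) ^ N := by positivity
    have p3 : 0 ≤ (1 + |z|) ^ N := by positivity
    have p4 : 0 ≤ (1 + |w|) ^ N := by positivity
    rcases hm with rfl | rfl | rfl | rfl <;> linarith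
  calc |∫ ω, X i ω ^ a * X j ω ^ b * X k ω ^ c * X l ω ^ d ∂P|
      ≤ ∫ ω, |X i ω ^ a * X j ω ^ b * X k ω ^ c * X l ω ^ d| ∂P := abs_integral_le_integral_abs
    _ ≤ ∫ ω, ((1 + |X i ω|) ^ N + (1 + |X j ω|) ^ N + (1 + |X k ω|) ^ N
          + (1 + |X l ω|) ^ N) ∂P :=
        integral_mono (h.moments_monomial i j k l a b c d).integrable.abs
          ((((hInt i).add (hInt j)).add (hInt k)).add (hInt l)) fun ω => hpt _ _ _ _
    _ = ∫ ω, (1 + |X i ω|) ^ N ∂P + ∫ ω, (1 + |X j ω|) ^ N ∂P + ∫ ω, (1 + |X k ω|) ^ N ∂P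
          + ∫ ω, (1 + |X l ω|) ^ N ∂P := by
        rw [integral_add, integral_add, integral_add]
        exacts [hInt i, hInt j, (hInt i).add (hInt j), hInt k, ((hInt i).add (hInt j)).add (hInt k),
          hInt l]
    _ ≤ _ := by
        linarith [h.integral_pow_bound i (hB i) N, h.integral_pow_bound j (hB j) N,
          h.integral_pow_bound k (hB k) N, h.integral_pow_bound l (hB l) N]

end IsCenteredGaussianFamily

/-- Products of powers of Gaussian variables decorrelate linearly in the cross-covariances. -/
lemma exists_abs_cov_monomial_le {Ω : Type*} [MeasurableSpace Ω] (P : Measure Ω)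
    [IsProbabilityMeasure P] (B : ℝ) (N a b c d : ℕ) (hab : a + b = N) :
    ∃ K : ℝ, 0 ≤ K ∧ ∀ (n : ℕ) (X : Fin n → Ω → ℝ) (ρ : Fin n → Fin n → ℝ),
      IsCenteredGaussianFamily P X ρ → (∀ i j, |ρ i j| ≤ B) → ∀ (i j k l : Fin n) (ε : ℝ),
      |ρ i k| ≤ ε → |ρ i l| ≤ ε → |ρ j k| ≤ ε → |ρ j l| ≤ ε →
      |∫ ω, X i ω ^ a * X j ω ^ b * X k ω ^ c * X l ω ^ d ∂P
        - (∫ ω, X i ω ^ a * X j ω ^ b ∂P) * ∫ ω, X k ω ^ c * X l ω ^ d ∂P| ≤ K * ε := by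
  induction N using Nat.strong_induction_on generalizing a b with
  | _ N ih =>
  -- reduction to the case of a positive first exponent
  have main : ∀ a b : ℕ, a + 1 + b = N → ∃ K : ℝ, 0 ≤ K ∧
      ∀ (n : ℕ) (X : Fin n → Ω → ℝ) (ρ : Fin n → Fin n → ℝ),
      IsCenteredGaussianFamily P X ρ → (∀ i j, |ρ i j| ≤ B) → ∀ (i j k l : Fin n) (ε : ℝ),
      |ρ i k| ≤ ε → |ρ i l| ≤ ε → |ρ j k| ≤ ε → |ρ j l| ≤ ε →
      |∫ ω, X i ω ^ (a + 1) * X j ω ^ b * X k ω ^ c * X l ω ^ d ∂P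
        - (∫ ω, X i ω ^ (a + 1) * X j ω ^ b ∂P) * ∫ ω, X k ω ^ c * X l ω ^ d ∂P| ≤ K * ε := by
    intro a b hN
    obtain ⟨K1, hK1, H1⟩ := ih (a - 1 + b) (by omega) (a - 1) b rfl
    obtain ⟨K2, hK2, H2⟩ := ih (a + (b - 1)) (by omega) a (b - 1) rfl
    set m1 := 4 * ∫ z, (1 + √B * |z|) ^ (a + b + (c - 1) + d) ∂(gaussianReal 0 1)
    set m2 := 4 * ∫ z, (1 + √B * |z|) ^ (a + b + c + (d - 1)) ∂(gaussianReal 0 1)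
    have hm1 : 0 ≤ m1 := by
      have : 0 ≤ ∫ z, (1 + √B * |z|) ^ (a + b + (c - 1) + d) ∂(gaussianReal 0 1) :=
        integral_nonneg fun z => by positivity
      positivity
    have hm2 : 0 ≤ m2 := by
      have : 0 ≤ ∫ z, (1 + √B * |z|) ^ (a + b + c + (d - 1)) ∂(gaussianReal 0 1) :=
        integral_nonneg fun z => by positivity
      positivity
    refine ⟨a * |B| * K1 + b * |B| * K2 + c * m1 + d * m2, by positivity, ?_⟩
    intro n X ρ h hB i j k l ε h1 h2 h3 h4
    have hε : 0 ≤ ε := (abs_nonneg _).trans h1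
    have hB' : ∀ i, ρ i i ≤ B := fun i => (le_abs_self _).trans (hB i i)
    have hBB : ∀ i j, |ρ i j| ≤ |B| := fun i j => (hB i j).trans (le_abs_self _)
    have r1 := h.integral_monomial_succ i j k l a b c d
    have r2 := h.integral_monomial_succ i j i i a b 0 0
    simp only [pow_zero, mul_one, Nat.cast_zero, zero_mul, add_zero] at r2
    have b1 := H1 n X ρ h hB i j k l ε h1 h2 h3 h4
    have b2 := H2 n X ρ h hB i j k l ε h1 h2 h3 h4
    have b3 := h.abs_integral_monomial_le hB' i j k l a b (c - 1) d
    have b4 := h.abs_integral_monomial_le hB' i j k l a b c (d - 1)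
    rw [r1, r2]
    set A1 := ∫ ω, X i ω ^ (a - 1) * X j ω ^ b * X k ω ^ c * X l ω ^ d ∂P
    set A2 := ∫ ω, X i ω ^ a * X j ω ^ (b - 1) * X k ω ^ c * X l ω ^ d ∂P
    set A3 := ∫ ω, X i ω ^ a * X j ω ^ b * X k ω ^ (c - 1) * X l ω ^ d ∂P
    set A4 := ∫ ω, X i ω ^ a * X j ω ^ b * X k ω ^ c * X l ω ^ (d - 1) ∂P
    set D1 := ∫ ω, X i ω ^ (a - 1) * X j ω ^ b ∂P
    set D2 := ∫ ω, X i ω ^ a * X j ω ^ (b - 1) ∂P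
    set R := ∫ ω, X k ω ^ c * X l ω ^ d ∂P
    have e : a * ρ i i * A1 + b * ρ i j * A2 + c * ρ i k * A3 + d * ρ i l * A4
        - (a * ρ i i * D1 + b * ρ i j * D2) * R
        = a * ρ i i * (A1 - D1 * R) + b * ρ i j * (A2 - D2 * R) + c * ρ i k * A3
          + d * ρ i l * A4 := by ring
    rw [e]
    have hmul : ∀ (m : ℕ) (r q y z : ℝ), |r| ≤ q → |y| ≤ z → |m * r * y| ≤ m * q * z := by
      intro m r q y z hr hy
      rw [abs_mul, abs_mul, Nat.abs_cast]
      exact mul_le_mul (mul_le_mul_of_nonneg_left hr m.cast_nonneg) hy (abs_nonneg _)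
        (mul_nonneg m.cast_nonneg ((abs_nonneg _).trans hr))
    refine ((abs_add_le _ _).trans (add_le_add ((abs_add_le _ _).trans (add_le_add
      ((abs_add_le _ _).trans (add_le_add (hmul a _ _ _ _ (hBB i i) b1)
        (hmul b _ _ _ _ (hBB i j) b2))) (hmul c _ _ _ _ h1 b3)))
          (hmul d _ _ _ _ h2 b4))).trans (le_of_eq ?_)
    ring
  rcases a with _ | a
  · rcases b with _ | b
    · refine ⟨0, le_rfl, ?_⟩
      intro n X ρ h hB i j k l ε h1 h2 h3 h4
      simp
    · obtain ⟨K, hK, H⟩ := main b 0 (by omega)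
      refine ⟨K, hK, ?_⟩
      intro n X ρ h hB i j k l ε h1 h2 h3 h4
      have := H n X ρ h hB j i k l ε h3 h4 h1 h2
      simpa using this
  · exact main a b hab

section OscillatoryIntegral

variable {Ω : Type*} [MeasurableSpace Ω] {P : Measure Ω}

/-- The integral of `p * exp (i Q)`. -/
def oscIntegral (P : Measure Ω) (Q p : Ω → ℝ) : ℂ :=
  ∫ ω, (p ω : ℂ) * Complex.exp (Q ω * Complex.I) ∂P

lemma integrable_mul_cexp {Q p : Ω → ℝ} (hQ : AEStronglyMeasurable Q P) (hp : Integrable p P) :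
    Integrable (fun ω => (p ω : ℂ) * Complex.exp (Q ω * Complex.I)) P := by
  refine Integrable.mono hp ?_ ?_
  · exact (Complex.continuous_ofReal.comp_aestronglyMeasurable hp.aestronglyMeasurable).mul
      ((by fun_prop : Continuous fun x : ℝ => Complex.exp (x * Complex.I)).comp_aestronglyMeasurable
        hQ)
  · exact ae_of_all _ fun ω => by simp [Complex.norm_exp_ofReal_mul_I]

lemma oscIntegral_add {Q p q : Ω → ℝ} (hQ : AEStronglyMeasurable Q P) (hp : Integrable p P)
    (hq : Integrable q P) :
    oscIntegral P Q (fun ω => p ω + q ω) = oscIntegral P Q p + oscIntegral P Q q := by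
  unfold oscIntegral
  rw [← integral_add (integrable_mul_cexp hQ hp) (integrable_mul_cexp hQ hq)]
  simp only [Complex.ofReal_add, add_mul]

lemma oscIntegral_const_mul (Q p : Ω → ℝ) (c : ℝ) :
    oscIntegral P Q (fun ω => c * p ω) = c * oscIntegral P Q p := by
  unfold oscIntegral
  rw [← integral_const_mul]
  simp only [Complex.ofReal_mul, mul_assoc]

lemma oscIntegral_sum {ι : Type*} (s : Finset ι) {Q : Ω → ℝ} {p : ι → Ω → ℝ}
    (hQ : AEStronglyMeasurable Q P) (hp : ∀ i, Integrable (p i) P) :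
    oscIntegral P Q (fun ω => ∑ i ∈ s, p i ω) = ∑ i ∈ s, oscIntegral P Q (p i) := by
  unfold oscIntegral
  rw [← integral_finsetSum _ fun i _ => integrable_mul_cexp hQ (hp i)]
  simp only [Complex.ofReal_sum, Finset.sum_mul]

lemma norm_oscIntegral_le (Q p : Ω → ℝ) : ‖oscIntegral P Q p‖ ≤ ∫ ω, |p ω| ∂P := by
  refine (norm_integral_le_integral_norm _).trans (le_of_eq ?_)
  simp [Complex.norm_exp_ofReal_mul_I]

lemma hasDerivAt_oscIntegral {F : Ω → ℝ} (hF : Integrable F P) [IsFiniteMeasure P] (t : ℝ) :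
    HasDerivAt (fun t : ℝ => oscIntegral P (fun ω => t * F ω) fun _ => 1)
      (Complex.I * oscIntegral P (fun ω => t * F ω) F) t := by
  have hm : ∀ t : ℝ, AEStronglyMeasurable (fun ω => t * F ω) P := fun t =>
    hF.aestronglyMeasurable.const_mul t
  have := (hasDerivAt_integral_of_dominated_loc_of_deriv_le (μ := P) (x₀ := t) (s := Set.univ)
    (F := fun (t : ℝ) ω => ((1 : ℝ) : ℂ) * Complex.exp ((t * F ω : ℝ) * Complex.I))
    (F' := fun (t : ℝ) ω => Complex.I * ((F ω : ℂ) * Complex.exp ((t * F ω : ℝ) * Complex.I)))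
    (bound := fun ω => |F ω|) univ_mem
    (Eventually.of_forall fun t =>
      (integrable_mul_cexp (hm t) (integrable_const (1 : ℝ))).aestronglyMeasurable)
    (integrable_mul_cexp (hm t) (integrable_const (1 : ℝ)))
    ((integrable_mul_cexp (hm t) hF).aestronglyMeasurable.const_mul _)
    (ae_of_all _ fun ω t _ => by simp only [norm_mul, Complex.norm_exp_ofReal_mul_I]; simp)
    hF.abs
    (ae_of_all _ fun ω t _ => by
      have h1 : HasDerivAt (fun t : ℝ => ((t * F ω : ℝ) : ℂ)) (F ω : ℂ) t := by
        have := ((hasDerivAt_id t).mul_const (F ω)).ofReal_comp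
        simpa using this
      refine ((h1.mul_const Complex.I).cexp.const_mul _).congr_deriv ?_
      simp
      ring)).2
  refine this.congr_deriv ?_
  rw [integral_const_mul]
  rfl

end OscillatoryIntegral

namespace IsCenteredGaussianFamily

variable {Ω : Type*} [MeasurableSpace Ω] {P : Measure Ω} [IsProbabilityMeasure P]
  {n : ℕ} {X : Fin n → Ω → ℝ} {ρ : Fin n → Fin n → ℝ}

/-- The centered quartic functional. -/
def quartic (s : ℝ) (ρ : Fin n → Fin n → ℝ) (x : Fin n → ℝ) : ℝ :=
  s * ∑ i, (x i ^ 4 - 3 * ρ i i ^ 2)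

/-- The carré du champ of `quartic` against its Ornstein–Uhlenbeck preimage. -/
def quarticGamma (s : ℝ) (ρ : Fin n → Fin n → ℝ) (x : Fin n → ℝ) : ℝ :=
  ∑ p : Fin n × Fin n, 4 * s ^ 2 * ρ p.1 p.2 *
    (x p.1 ^ 3 * x p.2 ^ 3 + 3 * ρ p.1 p.1 * (x p.1 * x p.2 ^ 3))

lemma moments_quartic (h : IsCenteredGaussianFamily P X ρ) (s : ℝ) :
    HasFiniteMoments (fun ω => quartic s ρ fun i => X i ω) P := by
  unfold quartic
  refine (HasFiniteMoments.sum _ fun i => ?_).const_mul s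
  simpa [sub_eq_add_neg] using ((h.moments i).pow 4).add (HasFiniteMoments.const (-(3 * ρ i i ^ 2)))

lemma moments_gammaTerm (h : IsCenteredGaussianFamily P X ρ) (i j : Fin n) :
    HasFiniteMoments (fun ω => X i ω ^ 3 * X j ω ^ 3 + 3 * ρ i i * (X i ω * X j ω ^ 3)) P :=
  (((h.moments i).pow 3).mul ((h.moments j).pow 3)).add
    (((h.moments i).mul ((h.moments j).pow 3)).const_mul _)

lemma oscIntegral_pow_succ (h : IsCenteredGaussianFamily P X ρ) (s l : ℝ) (i : Fin n) (k : ℕ) :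
    oscIntegral P (fun ω => l * quartic s ρ fun i => X i ω) (fun ω => X i ω ^ (k + 1))
      = (k * ρ i i : ℝ) * oscIntegral P (fun ω => l * quartic s ρ fun i => X i ω)
          (fun ω => X i ω ^ (k - 1))
        + Complex.I * oscIntegral P (fun ω => l * quartic s ρ fun i => X i ω)
          (fun ω => X i ω ^ k * ∑ j, l * s * (4 * ρ i j * X j ω ^ 3)) := by
  have hQ : AEStronglyMeasurable (fun ω => l * quartic s ρ fun i => X i ω) P :=
    (h.moments_quartic s).integrable.aestronglyMeasurable.const_mul l
  have hD : HasFiniteMoments (fun ω => X i ω ^ k * ∑ j, l * s * (4 * ρ i j * X j ω ^ 3)) P :=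
    ((h.moments i).pow k).mul (HasFiniteMoments.sum _ fun j =>
      (((h.moments j).pow 3).const_mul _).const_mul _)
  have hk := ((h.moments i).pow (k - 1)).const_mul (k * ρ i i)
  have hqc : Continuous (quartic s ρ) := by
    unfold quartic
    fun_prop
  have key := h.gauss.integral_smul_comp_eq h.mean i (C := ρ i) (h.cov i)
    (g := fun x => ((x i ^ k : ℝ) : ℂ) * Complex.exp ((l * quartic s ρ x : ℝ) * Complex.I))
    (g' := fun x => ((k * ρ i i * x i ^ (k - 1) : ℝ) : ℂ)
        * Complex.exp ((l * quartic s ρ x : ℝ) * Complex.I)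
      + Complex.I * (((x i ^ k * ∑ j, l * s * (4 * ρ i j * x j ^ 3) : ℝ) : ℂ)
        * Complex.exp ((l * quartic s ρ x : ℝ) * Complex.I)))
    (by
      intro x
      have hl : ∀ m, HasDerivAt (fun t : ℝ => (x + t • ρ i) m) (ρ i m) 0 := by
        intro m
        have := ((hasDerivAt_id (0 : ℝ)).mul_const (ρ i m)).const_add (x m)
        simpa using this
      have h1 := ((hl i).pow k).ofReal_comp
      have h2 : HasDerivAt (fun t : ℝ => l * quartic s ρ (x + t • ρ i))
          (∑ j, l * s * (4 * ρ i j * x j ^ 3)) 0 := by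
        have := ((HasDerivAt.fun_sum (u := Finset.univ) fun j _ =>
          ((hl j).pow 4).sub_const (3 * ρ j j ^ 2)).const_mul s).const_mul l
        refine this.congr_deriv ?_
        simp only [Finset.mul_sum]
        refine Finset.sum_congr rfl fun j _ => ?_
        simp
        ring
      refine (h1.mul (h2.ofReal_comp.mul_const Complex.I).cexp).congr_deriv ?_
      simp
      ring)
    (by fun_prop) (by fun_prop)
    (integrable_mul_cexp hQ ((h.moments i).pow k).integrable)
    ((integrable_mul_cexp hQ hk.integrable).add
      ((integrable_mul_cexp hQ hD.integrable).const_mul _))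
    (by
      refine (integrable_mul_cexp hQ ((h.moments i).pow (k + 1)).integrable).congr
        (ae_of_all _ fun ω => ?_)
      simp only [Complex.real_smul]
      push_cast
      ring)
  rw [integral_add (integrable_mul_cexp hQ hk.integrable)
      ((integrable_mul_cexp hQ hD.integrable).const_mul _), integral_const_mul] at key
  rw [← oscIntegral_const_mul]
  refine Eq.trans ?_ key
  unfold oscIntegral
  congr 1
  ext ω
  simp only [Complex.real_smul]
  push_cast
  ring

lemma oscIntegral_quartic (h : IsCenteredGaussianFamily P X ρ) (s l : ℝ) :
    oscIntegral P (fun ω => l * quartic s ρ fun i => X i ω) (fun ω => quartic s ρ fun i => X i ω)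
      = Complex.I * (l * oscIntegral P (fun ω => l * quartic s ρ fun i => X i ω)
          (fun ω => quarticGamma s ρ fun i => X i ω)) := by
  set Q := fun ω => l * quartic s ρ fun i => X i ω with hQdef
  have hQ : AEStronglyMeasurable Q P :=
    (h.moments_quartic s).integrable.aestronglyMeasurable.const_mul l
  have hS : ∀ i, HasFiniteMoments (fun ω => ∑ j, l * s * (4 * ρ i j * X j ω ^ 3)) P := fun i =>
    HasFiniteMoments.sum _ fun j => (((h.moments j).pow 3).const_mul _).const_mul _
  have hterm : ∀ i, oscIntegral P Q (fun ω => X i ω ^ 4 + -(3 * ρ i i ^ 2) * 1)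
      = Complex.I * oscIntegral P Q (fun ω => X i ω ^ 3 * (∑ j, l * s * (4 * ρ i j * X j ω ^ 3))
        + 3 * ρ i i * (X i ω ^ 1 * ∑ j, l * s * (4 * ρ i j * X j ω ^ 3))) := by
    intro i
    rw [oscIntegral_add hQ ((h.moments i).pow 4).integrable
        ((HasFiniteMoments.const 1).const_mul _).integrable, oscIntegral_const_mul,
      oscIntegral_add hQ (((h.moments i).pow 3).mul (hS i)).integrable
        ((((h.moments i).pow 1).mul (hS i)).const_mul _).integrable, oscIntegral_const_mul]
    have e3 := h.oscIntegral_pow_succ s l i 3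
    have e1 := h.oscIntegral_pow_succ s l i 1
    simp only [Nat.reduceAdd, Nat.reduceSub, pow_zero, ← hQdef] at e3 e1
    rw [e3, e1]
    push_cast
    ring
  have e1 : (fun ω => quartic s ρ fun i => X i ω)
      = fun ω => s * ∑ i, (X i ω ^ 4 + -(3 * ρ i i ^ 2) * 1) := by
    ext ω
    simp [quartic, sub_eq_add_neg]
  rw [e1, oscIntegral_const_mul, oscIntegral_sum _ hQ fun i =>
    (((h.moments i).pow 4).add ((HasFiniteMoments.const 1).const_mul _)).integrable]
  simp only [hterm]
  rw [← Finset.mul_sum, ← oscIntegral_sum _ hQ fun i => ((((h.moments i).pow 3).mul (hS i)).add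
        ((((h.moments i).pow 1).mul (hS i)).const_mul _)).integrable, mul_left_comm,
    ← oscIntegral_const_mul, ← oscIntegral_const_mul]
  congr 2
  ext ω
  simp only [quarticGamma, Fintype.sum_prod_type, Finset.mul_sum, ← Finset.sum_add_distrib]
  refine Finset.sum_congr rfl fun i _ => Finset.sum_congr rfl fun j _ => ?_
  ring

lemma integral_gammaTerm (h : IsCenteredGaussianFamily P X ρ) (i j : Fin n) :
    ∫ ω, (X i ω ^ 3 * X j ω ^ 3 + 3 * ρ i i * (X i ω * X j ω ^ 3)) ∂P
      = 18 * ρ i i * ρ j j * ρ i j + 6 * ρ i j ^ 3 := by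
  rw [integral_add (((h.moments i).pow 3).mul ((h.moments j).pow 3)).integrable
    (((h.moments i).mul ((h.moments j).pow 3)).const_mul _).integrable, integral_const_mul]
  have a1 := h.integral_monomial_succ i j j j 2 3 0 0
  have a2 := h.integral_monomial_succ j i i i 2 1 0 0
  have a3 := h.integral_monomial_succ i j j j 1 2 0 0
  have cjj := h.cov j j
  have cij := h.cov i j
  have hs := h.symm j i
  simp only [Nat.reduceAdd, Nat.reduceSub, pow_zero, mul_one, pow_one, Nat.cast_zero, zero_mul,
    add_zero, Nat.cast_ofNat, Nat.cast_one, one_mul, ← pow_two] at a1 a2 a3 cjj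
  have c1 : ∫ ω, X j ω * X i ω ∂P = ρ i j := by rw [h.cov, hs]
  have c2 : ∫ ω, X i ω * X j ω ^ 3 ∂P = 3 * ρ j j * ρ i j := by
    simp only [mul_comm (X i _)]
    rw [a2, c1, cjj, hs]
    ring
  rw [a1, a3, c2, cij, cjj]
  ring

lemma integral_quarticGamma (h : IsCenteredGaussianFamily P X ρ) (s : ℝ) :
    ∫ ω, quarticGamma s ρ (fun i => X i ω) ∂P
      = s ^ 2 * ∑ i, ∑ j, (72 * ρ i i * ρ j j * ρ i j ^ 2 + 24 * ρ i j ^ 4) := by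
  unfold quarticGamma
  rw [integral_finsetSum _ fun p _ => ((h.moments_gammaTerm p.1 p.2).const_mul _).integrable]
  simp only [integral_const_mul, h.integral_gammaTerm, Fintype.sum_prod_type, Finset.mul_sum]
  refine Finset.sum_congr rfl fun i _ => Finset.sum_congr rfl fun j _ => ?_
  ring

/-- Quantitative central limit theorem for the quartic functional, in terms of the variance of
`quarticGamma`. -/
lemma norm_charFun_quartic_sub_le (h : IsCenteredGaussianFamily P X ρ) (s W δ : ℝ)
    (hW : 0 ≤ W) (hδ : ∫ ω, |quarticGamma s ρ (fun i => X i ω) - W| ∂P ≤ δ) (l : ℝ) :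
    ‖oscIntegral P (fun ω => l * quartic s ρ fun i => X i ω) (fun _ => 1)
      - Complex.exp (-(l ^ 2 * W / 2 : ℝ))‖ ≤ l ^ 2 * δ := by
  have hF := (h.moments_quartic s).integrable
  have hG : HasFiniteMoments (fun ω => quarticGamma s ρ fun i => X i ω) P :=
    HasFiniteMoments.sum _ fun p => (h.moments_gammaTerm p.1 p.2).const_mul _
  set ψ : ℝ → ℂ := fun t => oscIntegral P (fun ω => t * quartic s ρ fun i => X i ω) (fun _ => 1)
    with hψ
  have hδ0 : 0 ≤ δ := (integral_nonneg fun ω => abs_nonneg _).trans hδ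
  let χ : ℝ → ℂ := fun t => ψ t * Complex.exp ((t ^ 2 * W / 2 : ℝ))
  have hχ : ∀ t : ℝ, HasDerivAt χ (-(t * Complex.exp ((t ^ 2 * W / 2 : ℝ)) *
      oscIntegral P (fun ω => t * quartic s ρ fun i => X i ω)
        (fun ω => quarticGamma s ρ (fun i => X i ω) + -W * 1))) t := by
    intro t
    have h1 := hasDerivAt_oscIntegral hF t
    have h2 : HasDerivAt (fun t : ℝ => ((t ^ 2 * W / 2 : ℝ) : ℂ)) ((t * W : ℝ) : ℂ) t := by
      refine HasDerivAt.ofReal_comp ?_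
      refine ((((hasDerivAt_id t).pow 2).mul_const W).div_const 2).congr_deriv ?_
      simp
      ring
    refine (h1.mul h2.cexp).congr_deriv ?_
    rw [h.oscIntegral_quartic s t, oscIntegral_add (hF.aestronglyMeasurable.const_mul t)
      hG.integrable ((HasFiniteMoments.const 1).const_mul _).integrable, oscIntegral_const_mul]
    push_cast
    linear_combination (t * oscIntegral P (fun ω => t * quartic s ρ fun i => X i ω)
      (fun ω => quarticGamma s ρ fun i => X i ω) * Complex.exp ((t : ℂ) ^ 2 * W / 2))
      * Complex.I_mul_I
  have hbound : ‖χ l - χ 0‖ ≤ |l| * Real.exp (l ^ 2 * W / 2) * δ * ‖l - 0‖ := by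
    refine (convex_uIcc (0 : ℝ) l).norm_image_sub_le_of_norm_hasDerivWithin_le
      (fun t _ => (hχ t).hasDerivWithinAt) (fun t ht => ?_) Set.left_mem_uIcc Set.right_mem_uIcc
    have htl : |t| ≤ |l| := by
      have := Set.abs_sub_left_of_mem_uIcc ht
      simpa using this
    rw [norm_neg, norm_mul, norm_mul, Complex.norm_real, Complex.norm_exp_ofReal, Real.norm_eq_abs]
    have hle := (norm_oscIntegral_le (P := P) (fun ω => t * quartic s ρ fun i => X i ω)
      (fun ω => quarticGamma s ρ (fun i => X i ω) + -W * 1))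
    simp only [mul_one, ← sub_eq_add_neg] at hle ⊢
    have hsq : t ^ 2 ≤ l ^ 2 := sq_le_sq.2 htl
    gcongr
    exact hle.trans hδ
  have h0 : χ 0 = 1 := by
    simp [χ, hψ, oscIntegral]
  have e : ψ l - Complex.exp (-(l ^ 2 * W / 2 : ℝ))
      = (χ l - χ 0) * Complex.exp (-(l ^ 2 * W / 2 : ℝ)) := by
    rw [h0, sub_mul, mul_assoc, ← Complex.exp_add]
    simp
  rw [e, norm_mul, ← Complex.ofReal_neg, Complex.norm_exp_ofReal]
  calc _ ≤ |l| * Real.exp (l ^ 2 * W / 2) * δ * ‖l - 0‖ * Real.exp (-(l ^ 2 * W / 2)) := by gcongr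
    _ = l ^ 2 * δ * (Real.exp (l ^ 2 * W / 2) * Real.exp (-(l ^ 2 * W / 2))) := by
      rw [sub_zero, Real.norm_eq_abs, ← sq_abs l]
      ring
    _ = l ^ 2 * δ := by
      rw [← Real.exp_add]
      simp

end IsCenteredGaussianFamily

lemma sum_mul_mul_chain_le {n : ℕ} {r : Fin n → Fin n → ℝ} {B : ℝ} (h0 : ∀ i j, 0 ≤ r i j)
    (hB : 0 ≤ B) (hrow : ∀ i, ∑ j, r i j ≤ B) :
    ∑ i, ∑ j, ∑ k, ∑ l, r i j * r k l * r i k ≤ n * B ^ 3 := by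
  have hk : ∀ i, ∑ k, ∑ l, r k l * r i k ≤ B ^ 2 := fun i => by
    calc ∑ k, ∑ l, r k l * r i k = ∑ k, (∑ l, r k l) * r i k := by simp_rw [Finset.sum_mul]
      _ ≤ ∑ k, B * r i k :=
        Finset.sum_le_sum fun k _ => mul_le_mul_of_nonneg_right (hrow k) (h0 i k)
      _ ≤ B ^ 2 := by
        rw [← Finset.mul_sum, pow_two]
        exact mul_le_mul_of_nonneg_left (hrow i) hB
  calc ∑ i, ∑ j, ∑ k, ∑ l, r i j * r k l * r i k
      = ∑ i, ∑ j, r i j * ∑ k, ∑ l, r k l * r i k := by simp_rw [Finset.mul_sum, mul_assoc]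
    _ ≤ ∑ i, ∑ j, r i j * B ^ 2 := by
        gcongr with i _ j _
        exacts [h0 i j, hk i]
    _ ≤ ∑ _i : Fin n, B * B ^ 2 := by
        refine Finset.sum_le_sum fun i _ => ?_
        rw [← Finset.sum_mul]
        exact mul_le_mul_of_nonneg_right (hrow i) (by positivity)
    _ = n * B ^ 3 := by
        rw [Finset.sum_const, Finset.card_univ, Fintype.card_fin, nsmul_eq_mul]
        ring

lemma sum_mul_mul_cross_le {n : ℕ} {r : Fin n → Fin n → ℝ} {B : ℝ} (h0 : ∀ i j, 0 ≤ r i j)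
    (hs : ∀ i j, r i j = r j i) (hB : 0 ≤ B) (hrow : ∀ i, ∑ j, r i j ≤ B) :
    ∑ i, ∑ j, ∑ k, ∑ l, r i j * r k l * (r i k + r i l + r j k + r j l) ≤ 4 * (n * B ^ 3) := by
  have h1 := sum_mul_mul_chain_le h0 hB hrow
  have h2 : ∑ i, ∑ j, ∑ k, ∑ l, r i j * r k l * r i l ≤ n * B ^ 3 := by
    refine le_of_eq_of_le ?_ h1
    refine Finset.sum_congr rfl fun i _ => Finset.sum_congr rfl fun j _ => ?_
    rw [Finset.sum_comm]
    exact Finset.sum_congr rfl fun k _ => Finset.sum_congr rfl fun l _ => by rw [hs l k]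
  have h3 : ∑ i, ∑ j, ∑ k, ∑ l, r i j * r k l * r j k ≤ n * B ^ 3 := by
    refine le_of_eq_of_le ?_ h1
    rw [Finset.sum_comm]
    exact Finset.sum_congr rfl fun i _ => Finset.sum_congr rfl fun j _ => by rw [hs j i]
  have h4 : ∑ i, ∑ j, ∑ k, ∑ l, r i j * r k l * r j l ≤ n * B ^ 3 := by
    refine le_of_eq_of_le ?_ h2
    rw [Finset.sum_comm]
    exact Finset.sum_congr rfl fun i _ => Finset.sum_congr rfl fun j _ => by rw [hs j i]
  simp only [mul_add, Finset.sum_add_distrib]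
  linarith

namespace IsCenteredGaussianFamily

/-- The summand of the carré du champ `quarticGamma`. -/
def gammaTerm {Ω : Type*} {n : ℕ} (X : Fin n → Ω → ℝ) (ρ : Fin n → Fin n → ℝ) (i j : Fin n)
    (ω : Ω) : ℝ :=
  X i ω ^ 3 * X j ω ^ 3 + 3 * ρ i i * (X i ω * X j ω ^ 3)

lemma exists_abs_cov_gammaTerm_le {Ω : Type*} [MeasurableSpace Ω] (P : Measure Ω)
    [IsProbabilityMeasure P] (B : ℝ) :
    ∃ K : ℝ, 0 ≤ K ∧ ∀ (n : ℕ) (X : Fin n → Ω → ℝ) (ρ : Fin n → Fin n → ℝ),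
      IsCenteredGaussianFamily P X ρ → (∀ i j, |ρ i j| ≤ B) → ∀ (i j k l : Fin n) (ε : ℝ),
      |ρ i k| ≤ ε → |ρ i l| ≤ ε → |ρ j k| ≤ ε → |ρ j l| ≤ ε →
      |cov[gammaTerm X ρ i j, gammaTerm X ρ k l; P]| ≤ K * ε := by
  obtain ⟨K1, h1, H1⟩ := exists_abs_cov_monomial_le P B _ 3 3 3 3 rfl
  obtain ⟨K2, h2, H2⟩ := exists_abs_cov_monomial_le P B _ 3 3 1 3 rfl
  obtain ⟨K3, h3, H3⟩ := exists_abs_cov_monomial_le P B _ 1 3 3 3 rfl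
  obtain ⟨K4, h4, H4⟩ := exists_abs_cov_monomial_le P B _ 1 3 1 3 rfl
  refine ⟨K1 + 3 * |B| * K2 + 3 * |B| * K3 + 9 * |B| ^ 2 * K4, by positivity,
    fun n X ρ h hB i j k l ε e1 e2 e3 e4 => ?_⟩
  replace H1 := H1 n X ρ h hB i j k l ε e1 e2 e3 e4
  replace H2 := H2 n X ρ h hB i j k l ε e1 e2 e3 e4
  replace H3 := H3 n X ρ h hB i j k l ε e1 e2 e3 e4
  replace H4 := H4 n X ρ h hB i j k l ε e1 e2 e3 e4
  have M33 : ∀ i j, MemLp (fun ω => X i ω ^ 3 * X j ω ^ 3) 2 P := fun i j =>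
    (((h.moments i).pow 3).mul ((h.moments j).pow 3)) 2 (by simp)
  have M13 : ∀ i j, MemLp (fun ω => X i ω * X j ω ^ 3) 2 P := fun i j =>
    ((h.moments i).mul ((h.moments j).pow 3)) 2 (by simp)
  have M13' : ∀ i j c, MemLp (fun ω => c * (X i ω * X j ω ^ 3)) 2 P := fun i j c =>
    (M13 i j).const_mul c
  have hρ : ∀ i, |ρ i i| ≤ |B| := fun i => (hB i i).trans (le_abs_self B)
  have hε : 0 ≤ ε := (abs_nonneg _).trans e1
  simp only [pow_one, mul_assoc] at H1 H2 H3 H4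
  have key : ∀ c1 c2 c3 c4 : ℝ, |c1| ≤ K1 * ε → |c2| ≤ K2 * ε → |c3| ≤ K3 * ε → |c4| ≤ K4 * ε →
      |c1 + 3 * ρ k k * c2 + (3 * ρ i i * c3 + 3 * ρ i i * (3 * ρ k k * c4))|
        ≤ (K1 + 3 * |B| * K2 + 3 * |B| * K3 + 9 * |B| ^ 2 * K4) * ε := by
    intro c1 c2 c3 c4 b1 b2 b3 b4
    calc |c1 + 3 * ρ k k * c2 + (3 * ρ i i * c3 + 3 * ρ i i * (3 * ρ k k * c4))|
        ≤ |c1| + 3 * |ρ k k| * |c2| + (3 * |ρ i i| * |c3|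
            + 3 * |ρ i i| * (3 * |ρ k k| * |c4|)) := by
          refine (abs_add_le _ _).trans (add_le_add ((abs_add_le _ _).trans ?_)
            ((abs_add_le _ _).trans ?_))
          · simp [abs_mul]
          · simp [abs_mul]
      _ ≤ K1 * ε + 3 * |B| * (K2 * ε) + (3 * |B| * (K3 * ε)
            + 3 * |B| * (3 * |B| * (K4 * ε))) := by
          have hi := hρ i
          have hk := hρ k
          have hi0 := abs_nonneg (ρ i i)
          have hk0 := abs_nonneg (ρ k k)
          have hB0 := abs_nonneg B
          generalize |ρ i i| = ri at *
          generalize |ρ k k| = rk at *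
          generalize |B| = B' at *
          gcongr
      _ = _ := by ring
  have eA : ∀ i j, gammaTerm X ρ i j = (fun ω => X i ω ^ 3 * X j ω ^ 3)
      + fun ω => 3 * ρ i i * (X i ω * X j ω ^ 3) := fun i j => rfl
  rw [eA, eA, covariance_add_left (M33 i j) (M13' i j _) ((M33 k l).add (M13' k l _)),
    covariance_add_right (M33 i j) (M33 k l) (M13' k l _),
    covariance_add_right (M13' i j _) (M33 k l) (M13' k l _),
    covariance_const_mul_left, covariance_const_mul_left, covariance_const_mul_right,
    covariance_const_mul_right,
    covariance_eq_sub (M33 i j) (M33 k l), covariance_eq_sub (M33 i j) (M13 k l),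
    covariance_eq_sub (M13 i j) (M33 k l), covariance_eq_sub (M13 i j) (M13 k l)]
  refine key _ _ _ _ ?_ ?_ ?_ ?_ <;> simpa only [Pi.mul_apply, mul_assoc]

lemma exists_variance_quarticGamma_le {Ω : Type*} [MeasurableSpace Ω] (P : Measure Ω)
    [IsProbabilityMeasure P] (B : ℝ) (hB0 : 0 ≤ B) :
    ∃ K : ℝ, 0 ≤ K ∧ ∀ (n : ℕ) (X : Fin n → Ω → ℝ) (ρ : Fin n → Fin n → ℝ) (s : ℝ),
      IsCenteredGaussianFamily P X ρ → (∀ i, ∑ j, |ρ i j| ≤ B) →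
      Var[fun ω => quarticGamma s ρ fun i => X i ω; P] ≤ K * s ^ 4 * n := by
  obtain ⟨K, hK, H⟩ := exists_abs_cov_gammaTerm_le P B
  refine ⟨64 * K * B ^ 3, by positivity, fun n X ρ s h hrow => ?_⟩
  have hB : ∀ i j, |ρ i j| ≤ B := fun i j =>
    (Finset.single_le_sum (f := fun j => |ρ i j|) (fun _ _ => abs_nonneg _)
      (Finset.mem_univ j)).trans (hrow i)
  have e : (fun ω => quarticGamma s ρ fun i => X i ω)
      = fun ω => ∑ p : Fin n × Fin n, 4 * s ^ 2 * ρ p.1 p.2 * gammaTerm X ρ p.1 p.2 ω := rfl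
  have hM : ∀ p : Fin n × Fin n,
      MemLp (fun ω => 4 * s ^ 2 * ρ p.1 p.2 * gammaTerm X ρ p.1 p.2 ω) 2 P :=
    fun p => (h.moments_gammaTerm p.1 p.2).const_mul _ 2 (by simp)
  rw [e, variance_fun_sum hM]
  simp only [covariance_const_mul_left, covariance_const_mul_right, Fintype.sum_prod_type]
  calc _ ≤ ∑ i, ∑ j, ∑ k, ∑ l, 16 * s ^ 4 * K * (|ρ i j| * |ρ k l| *
          (|ρ i k| + |ρ i l| + |ρ j k| + |ρ j l|)) := by
        refine Finset.sum_le_sum fun i _ => Finset.sum_le_sum fun j _ =>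
          Finset.sum_le_sum fun k _ => Finset.sum_le_sum fun l _ => ?_
        have hc := H n X ρ h hB i j k l (|ρ i k| + |ρ i l| + |ρ j k| + |ρ j l|)
          (by linarith [abs_nonneg (ρ i l), abs_nonneg (ρ j k), abs_nonneg (ρ j l)])
          (by linarith [abs_nonneg (ρ i k), abs_nonneg (ρ j k), abs_nonneg (ρ j l)])
          (by linarith [abs_nonneg (ρ i l), abs_nonneg (ρ i k), abs_nonneg (ρ j l)])
          (by linarith [abs_nonneg (ρ i l), abs_nonneg (ρ j k), abs_nonneg (ρ i k)])
        refine (le_abs_self _).trans ?_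
        rw [abs_mul, abs_mul, abs_mul _ (cov[_, _; P]), abs_mul _ (ρ i j),
          abs_of_nonneg (by positivity : 0 ≤ 4 * s ^ 2)]
        calc _ ≤ 4 * s ^ 2 * |ρ k l| * (4 * s ^ 2 * |ρ i j| *
              (K * (|ρ i k| + |ρ i l| + |ρ j k| + |ρ j l|))) := by gcongr
          _ = _ := by ring
    _ = 16 * s ^ 4 * K * ∑ i, ∑ j, ∑ k, ∑ l, (|ρ i j| * |ρ k l| *
          (|ρ i k| + |ρ i l| + |ρ j k| + |ρ j l|)) := by simp_rw [Finset.mul_sum]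
    _ ≤ 16 * s ^ 4 * K * (4 * (n * B ^ 3)) := by
        gcongr
        exact sum_mul_mul_cross_le (r := fun i j => |ρ i j|) (fun _ _ => abs_nonneg _)
          (fun i j => by rw [h.symm]) hB0 hrow
    _ = _ := by ring

/-- Quantitative central limit theorem for the normalized quartic functional. -/
lemma exists_norm_charFun_quartic_sub_le {Ω : Type*} [MeasurableSpace Ω] (P : Measure Ω)
    [IsProbabilityMeasure P] (B : ℝ) (hB0 : 0 ≤ B) :
    ∃ K : ℝ, 0 ≤ K ∧ ∀ (n : ℕ) (X : Fin n → Ω → ℝ) (ρ : Fin n → Fin n → ℝ),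
      IsCenteredGaussianFamily P X ρ → (∀ i, ∑ j, |ρ i j| ≤ B) → 0 < n → ∀ l : ℝ,
      ‖oscIntegral P (fun ω => l * quartic (1 / √n) ρ fun i => X i ω) (fun _ => 1)
        - Complex.exp (-(l ^ 2 * ((1 / n) * ∑ i, ∑ j,
          (72 * ρ i i * ρ j j * ρ i j ^ 2 + 24 * ρ i j ^ 4)) / 2 : ℝ))‖ ≤ l ^ 2 * √(K / n) := by
  obtain ⟨K, hK, H⟩ := exists_variance_quarticGamma_le P B hB0
  refine ⟨K, hK, fun n X ρ h hrow hn l => ?_⟩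
  have hn' : (0 : ℝ) < n := by exact_mod_cast hn
  have hW := h.integral_quarticGamma (1 / √n)
  have hs2 : (1 / √(n : ℝ)) ^ 2 = 1 / n := by
    rw [div_pow, Real.sq_sqrt hn'.le, one_pow]
  rw [hs2] at hW
  refine h.norm_charFun_quartic_sub_le _ _ _ ?_ ?_ l
  · refine mul_nonneg (by positivity) (Finset.sum_nonneg fun i _ => Finset.sum_nonneg fun j _ => ?_)
    have := h.nonneg i
    have := h.nonneg j
    positivity
  · rw [← hW]
    have hG : HasFiniteMoments (fun ω => quarticGamma (1 / √n) ρ fun i => X i ω) P :=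
      HasFiniteMoments.sum _ fun p => (h.moments_gammaTerm p.1 p.2).const_mul _
    set G := fun ω => quarticGamma (1 / √n) ρ fun i => X i ω
    set m := ∫ ω, G ω ∂P
    have hGm : HasFiniteMoments (fun ω => G ω - m) P := by
      simpa [sub_eq_add_neg] using hG.add (HasFiniteMoments.const (-m))
    have hv := H n X ρ (1 / √n) h hrow
    have hv' : (1 / √(n : ℝ)) ^ 4 * n = 1 / n := by
      rw [show (4 : ℕ) = 2 * 2 from rfl, pow_mul, hs2]
      field_simp
    rw [variance_eq_integral hG.integrable.aemeasurable, mul_assoc, hv', mul_one_div] at hv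
    refine Real.le_sqrt_of_sq_le (le_trans ?_ hv)
    have hj := variance_nonneg (fun ω => |G ω - m|) P
    rw [variance_eq_sub (show MemLp (fun ω => |G ω - m|) 2 P from (hGm 2 (by simp)).abs)] at hj
    have hj' : (∫ ω, |G ω - m| ∂P) ^ 2 ≤ ∫ ω, (G ω - m) ^ 2 ∂P := by
      simpa [sub_nonneg] using hj
    exact hj'

end IsCenteredGaussianFamily

section ThetaSeries

lemma summable_exp_neg_mul_add_one_sq {c : ℝ} (hc : 0 < c) :
    Summable fun n : ℕ => Real.exp (-(c * ((n : ℝ) + 1) ^ 2)) := by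
  have h := Real.summable_exp_nat_mul_iff.2 (neg_lt_zero.2 hc)
  refine Summable.of_nonneg_of_le (fun n => (Real.exp_pos _).le) (fun n => ?_) h
  rw [Real.exp_le_exp]
  nlinarith [sq_nonneg (n : ℝ), Nat.cast_nonneg (α := ℝ) n, mul_nonneg hc.le (sq_nonneg (n : ℝ)),
    mul_nonneg hc.le (Nat.cast_nonneg (α := ℝ) n)]

lemma summable_exp_neg_mul_int_sq {c : ℝ} (hc : 0 < c) :
    Summable fun n : ℤ => Real.exp (-(c * (n : ℝ) ^ 2)) := by
  have h := summable_exp_neg_mul_add_one_sq hc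
  have h' : Summable fun n : ℕ => Real.exp (-(c * (n : ℝ) ^ 2)) := by
    rw [← summable_nat_add_iff 1]
    simpa using h
  exact Summable.of_nat_of_neg (by simpa using h') (by simpa using h')

lemma summable_inv_pi_mul_sub_pow_four (y : ℝ) :
    Summable fun n : ℤ => 1 / (π * n - y) ^ 4 := by
  have h := (Real.summable_one_div_int_add_rpow (-(y / π)) 4).2 (by norm_num)
  refine (h.mul_left (1 / π ^ 4)).congr fun n => ?_
  have e : π * n - y = π * (n + -(y / π)) := by
    field_simp
    ring
  rw [e, mul_pow, show ((4 : ℝ) = ((4 : ℕ) : ℝ)) by norm_num, Real.rpow_natCast, Even.pow_abs (by decide : Even 4)]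
  field_simp

/-- Poisson summation for Gaussian cosine series. -/
lemma tsum_exp_neg_mul_int_sq_mul_cos {c : ℝ} (hc : 0 < c) (x : ℝ) :
    ∑' n : ℤ, Real.exp (-(c * (n : ℝ) ^ 2)) * Real.cos (2 * n * x)
      = √(π / c) * ∑' n : ℤ, Real.exp (-((π * n - x) ^ 2 / c)) := by
  have hπ := Real.pi_pos
  have hπ' : (π : ℂ) ≠ 0 := by exact_mod_cast hπ.ne'
  have hc' : (c : ℂ) ≠ 0 := by exact_mod_cast hc.ne'
  have key := Complex.tsum_exp_neg_quadratic (a := ((c / π : ℝ) : ℂ))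
    (by rw [Complex.ofReal_re]; positivity) ((x / π : ℝ) * Complex.I)
  have e1 : ∀ n : ℤ, Complex.exp (-π * ((c / π : ℝ) : ℂ) * n ^ 2
      + 2 * π * ((x / π : ℝ) * Complex.I) * n)
      = ((Real.exp (-(c * (n : ℝ) ^ 2)) : ℝ) : ℂ) * Complex.exp ((2 * n * x : ℝ) * Complex.I) := by
    intro n
    rw [Complex.ofReal_exp, ← Complex.exp_add]
    congr 1
    push_cast
    field_simp
  have e2 : ∀ n : ℤ, Complex.exp (-π / ((c / π : ℝ) : ℂ) * (n + Complex.I * ((x / π : ℝ) * Complex.I)) ^ 2)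
      = ((Real.exp (-((π * n - x) ^ 2 / c)) : ℝ) : ℂ) := by
    intro n
    rw [Complex.ofReal_exp]
    congr 1
    have : Complex.I * ((x / π : ℝ) * Complex.I) = -(x / π : ℝ) := by
      linear_combination ((x / π : ℝ) : ℂ) * Complex.I_mul_I
    rw [this]
    push_cast
    field_simp
    ring
  simp only [e1, e2] at key
  rw [← Complex.ofReal_tsum] at key
  have e3 : (1 : ℂ) / ((c / π : ℝ) : ℂ) ^ (1 / 2 : ℂ) = ((√(π / c) : ℝ) : ℂ) := by
    rw [show (1 / 2 : ℂ) = ((1 / 2 : ℝ) : ℂ) by push_cast; rfl, ← Complex.ofReal_cpow (by positivity),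
      ← Real.sqrt_eq_rpow, ← Complex.ofReal_one, ← Complex.ofReal_div, one_div, ← Real.sqrt_inv,
      inv_div]
  rw [e3] at key
  have hs : Summable fun n : ℤ => ((Real.exp (-(c * (n : ℝ) ^ 2)) : ℝ) : ℂ)
      * Complex.exp ((2 * n * x : ℝ) * Complex.I) := by
    refine Summable.of_norm ((summable_exp_neg_mul_int_sq hc).congr fun n => ?_)
    rw [norm_mul, Complex.norm_exp_ofReal_mul_I, mul_one, Complex.norm_real, Real.norm_eq_abs,
      abs_of_pos (Real.exp_pos _)]
  have := congrArg Complex.re key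
  rw [Complex.re_tsum hs, ← Complex.ofReal_mul, Complex.ofReal_re] at this
  rw [← this]
  refine tsum_congr fun n => ?_
  rw [Complex.re_ofReal_mul, Complex.exp_ofReal_mul_I_re]

lemma exp_neg_div_le {c y : ℝ} (hc : 0 < c) (hy : y ≠ 0) :
    Real.exp (-(y ^ 2 / c)) ≤ 2 * c ^ 2 / y ^ 4 := by
  have hw : 0 < y ^ 2 / c := by positivity
  have h := Real.quadratic_le_exp_of_nonneg hw.le
  rw [Real.exp_neg, inv_le_comm₀ (Real.exp_pos _) (by positivity)]
  have e : (2 * c ^ 2 / y ^ 4)⁻¹ = (y ^ 2 / c) ^ 2 / 2 := by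
    field_simp
  rw [e]
  linarith

lemma summable_exp_neg_pi_mul_sub_sq {c : ℝ} (hc : 0 < c) {y : ℝ} (hy : ∀ n : ℤ, n ≠ 0 → π * n - y ≠ 0) :
    Summable fun n : ℤ => Real.exp (-((π * n - y) ^ 2 / c)) := by
  have h := ((summable_inv_pi_mul_sub_pow_four y).mul_left (2 * c ^ 2)).add
    (hasSum_ite_eq (0 : ℤ) (1 : ℝ)).summable
  refine Summable.of_nonneg_of_le (fun n => (Real.exp_pos _).le) (fun n => ?_) h
  by_cases hn : n = 0
  · have h1 : Real.exp (-((π * n - y) ^ 2 / c)) ≤ 1 := by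
      rw [Real.exp_le_one_iff]
      have : 0 ≤ (π * n - y) ^ 2 / c := by positivity
      linarith
    have h2 : 0 ≤ 2 * c ^ 2 * (1 / (π * n - y) ^ 4) := by positivity
    simp only [hn, if_true] at *
    linarith
  · have := exp_neg_div_le hc (hy n hn)
    simp only [hn, if_false, add_zero, mul_one_div]
    exact this

lemma pi_mul_int_sub_ne_zero {x : ℝ} (hx : x ∈ Set.Ioo 0 π) (n : ℤ) : π * n - x ≠ 0 := by
  intro h
  have hπ := Real.pi_pos
  have h1 : 0 < π * n := by linarith [hx.1]
  have h2 : π * n < π * 1 := by linarith [hx.2]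
  have h3 : (0 : ℝ) < n := pos_of_mul_pos_right h1 hπ.le
  have h4 : (n : ℝ) < 1 := lt_of_mul_lt_mul_left h2 hπ.le
  norm_cast at h3 h4
  omega

lemma tsum_sin_sq_mul_exp {c : ℝ} (hc : 0 < c) {x : ℝ} (hx : x ∈ Set.Ioo 0 π) :
    ∑' k : ℕ, 2 * Real.sin (((k : ℝ) + 1) * x) ^ 2 * Real.exp (-(c * ((k : ℝ) + 1) ^ 2))
      = √(π / c) / 2 * ∑' n : ℤ, (Real.exp (-((π * n) ^ 2 / c))
          - Real.exp (-((π * n - x) ^ 2 / c))) := by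
  have hπ := Real.pi_pos
  set g : ℤ → ℝ := fun n => Real.exp (-(c * (n : ℝ) ^ 2)) - Real.exp (-(c * (n : ℝ) ^ 2)) * Real.cos (2 * n * x)
    with hg
  have hs := summable_exp_neg_mul_int_sq hc
  have hsc : Summable fun n : ℤ => Real.exp (-(c * (n : ℝ) ^ 2)) * Real.cos (2 * n * x) := by
    refine Summable.of_norm_bounded hs fun n => ?_
    rw [norm_mul, Real.norm_eq_abs, Real.norm_eq_abs, abs_of_pos (Real.exp_pos _)]
    exact mul_le_of_le_one_right (Real.exp_pos _).le (Real.abs_cos_le_one _)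
  have hgs : Summable g := hs.sub hsc
  have hg0 : g 0 = 0 := by simp [hg]
  have hgk : ∀ k : ℕ, g ((k : ℤ) + 1) = 2 * Real.sin (((k : ℝ) + 1) * x) ^ 2 * Real.exp (-(c * ((k : ℝ) + 1) ^ 2)) := by
    intro k
    simp only [hg]
    push_cast
    rw [Real.sin_sq_eq_half_sub, ← mul_assoc]
    ring
  have hgn : ∀ k : ℕ, g (-((k : ℤ) + 1)) = g ((k : ℤ) + 1) := by
    intro k
    simp only [hg]
    push_cast
    rw [neg_sq, show 2 * (-((k : ℝ) + 1)) * x = -(2 * ((k : ℝ) + 1) * x) by ring, Real.cos_neg]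
  have hgs' : Summable fun k : ℕ => g ((k : ℤ) + 1) := by
    refine (hgs.comp_injective (i := fun k : ℕ => (k : ℤ) + 1) fun a b h => ?_)
    simpa using h
  have h1 : ∑' n, g n = 2 * ∑' k : ℕ, g ((k : ℤ) + 1) := by
    have a1 : HasSum (fun k : ℕ => g k) (∑' k : ℕ, g ((k : ℤ) + 1)) := by
      have := (hasSum_nat_add_iff (f := fun k : ℕ => g k) 1 (g := ∑' k : ℕ, g ((k : ℤ) + 1))).1
        (by simpa using hgs'.hasSum)
      simpa [hg0] using this
    have a2 : HasSum (fun k : ℕ => g (-((k : ℤ) + 1))) (∑' k : ℕ, g ((k : ℤ) + 1)) := by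
      simpa only [hgn] using hgs'.hasSum
    rw [(HasSum.of_nat_of_neg_add_one a1 a2).tsum_eq, two_mul]
  have p1 := tsum_exp_neg_mul_int_sq_mul_cos hc x
  have p0 := tsum_exp_neg_mul_int_sq_mul_cos hc 0
  simp only [mul_zero, Real.cos_zero, mul_one, sub_zero] at p0
  have h2 : ∑' n, g n = √(π / c) * ∑' n : ℤ, (Real.exp (-((π * n) ^ 2 / c))
          - Real.exp (-((π * n - x) ^ 2 / c))) := by
    have s0 := summable_exp_neg_pi_mul_sub_sq hc (y := 0) (fun n hn => by
      rw [sub_zero]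
      exact mul_ne_zero hπ.ne' (by exact_mod_cast hn))
    simp only [sub_zero] at s0
    rw [s0.tsum_sub (summable_exp_neg_pi_mul_sub_sq hc fun n _ => pi_mul_int_sub_ne_zero hx n),
      mul_sub, ← p0, ← p1, ← hs.tsum_sub hsc]
  simp only [← hgk]
  linarith

end ThetaSeries

section HeatSeries

/-- The (rescaled) variogram series of the stationary part of the heat equation. -/
def heatSeries (θ x τ : ℝ) : ℝ :=
  ∑' k : ℕ, 2 * Real.sin (((k : ℝ) + 1) * x) ^ 2 / ((k : ℝ) + 1) ^ 2 *
    (1 - Real.exp (-(θ * ((k : ℝ) + 1) ^ 2 * τ)))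

lemma summable_two_div_add_one_sq : Summable fun k : ℕ => 2 / ((k : ℝ) + 1) ^ 2 := by
  have h : Summable fun k : ℕ => 2 / (k : ℝ) ^ 2 := by
    simpa [div_eq_mul_inv] using (Real.summable_nat_pow_inv.2 one_lt_two).mul_left 2
  simpa using (summable_nat_add_iff 1).2 h

lemma abs_heatSeries_term_le {θ x τ : ℝ} (hθ : 0 < θ) (hτ : 0 ≤ τ) (k : ℕ) :
    |2 * Real.sin (((k : ℝ) + 1) * x) ^ 2 / ((k : ℝ) + 1) ^ 2 *
      (1 - Real.exp (-(θ * ((k : ℝ) + 1) ^ 2 * τ)))| ≤ 2 / ((k : ℝ) + 1) ^ 2 := by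
  have h1 : Real.exp (-(θ * ((k : ℝ) + 1) ^ 2 * τ)) ≤ 1 := by
    rw [Real.exp_le_one_iff]
    have : 0 ≤ θ * ((k : ℝ) + 1) ^ 2 * τ := by positivity
    linarith
  have h2 := Real.exp_pos (-(θ * ((k : ℝ) + 1) ^ 2 * τ))
  have h3 := Real.sin_sq_le_one (((k : ℝ) + 1) * x)
  rw [abs_of_nonneg (mul_nonneg (by positivity) (by linarith))]
  calc _ ≤ 2 * 1 / ((k : ℝ) + 1) ^ 2 * 1 := by
        gcongr
        linarith
    _ = _ := by ring

lemma summable_heatSeries {θ x τ : ℝ} (hθ : 0 < θ) (hτ : 0 ≤ τ) :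
    Summable fun k : ℕ => 2 * Real.sin (((k : ℝ) + 1) * x) ^ 2 / ((k : ℝ) + 1) ^ 2 *
      (1 - Real.exp (-(θ * ((k : ℝ) + 1) ^ 2 * τ))) :=
  Summable.of_norm_bounded summable_two_div_add_one_sq fun k => abs_heatSeries_term_le hθ hτ k

lemma continuousOn_heatSeries {θ : ℝ} (hθ : 0 < θ) (x : ℝ) :
    ContinuousOn (heatSeries θ x) (Set.Ici 0) :=
  continuousOn_tsum (fun k => by fun_prop) summable_two_div_add_one_sq
    fun k τ hτ => abs_heatSeries_term_le hθ hτ k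

lemma heatSeries_zero (θ x : ℝ) : heatSeries θ x 0 = 0 := by
  simp [heatSeries]

lemma hasDerivAt_heatSeries_series {θ x τ : ℝ} (hθ : 0 < θ) (hτ : 0 < τ) :
    HasDerivAt (heatSeries θ x) (∑' k : ℕ, θ * (2 * Real.sin (((k : ℝ) + 1) * x) ^ 2 *
      Real.exp (-(θ * τ * ((k : ℝ) + 1) ^ 2)))) τ := by
  have hε : 0 < θ * (τ / 2) := by positivity
  refine hasDerivAt_tsum_of_isPreconnected
    (u := fun k : ℕ => θ * 2 * Real.exp (-(θ * (τ / 2) * ((k : ℝ) + 1) ^ 2)))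
    (g := fun (k : ℕ) τ => 2 * Real.sin (((k : ℝ) + 1) * x) ^ 2 / ((k : ℝ) + 1) ^ 2 *
      (1 - Real.exp (-(θ * ((k : ℝ) + 1) ^ 2 * τ))))
    (g' := fun (k : ℕ) τ => θ * (2 * Real.sin (((k : ℝ) + 1) * x) ^ 2 *
      Real.exp (-(θ * τ * ((k : ℝ) + 1) ^ 2))))
    (t := Set.Ioi (τ / 2)) (y₀ := τ)
    ((summable_exp_neg_mul_add_one_sq hε).mul_left _) isOpen_Ioi isPreconnected_Ioi
    (fun k y _ => ?_) (fun k y hy => ?_) (by simp [hτ]) (summable_heatSeries hθ hτ.le)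
    (by simp [hτ])
  · have h1 : HasDerivAt (fun y : ℝ => -(θ * ((k : ℝ) + 1) ^ 2 * y)) (-(θ * ((k : ℝ) + 1) ^ 2)) y := by
      simpa using ((hasDerivAt_id y).const_mul (θ * ((k : ℝ) + 1) ^ 2)).fun_neg
    refine ((h1.exp.const_sub 1).const_mul _).congr_deriv ?_
    rw [show θ * y * ((k : ℝ) + 1) ^ 2 = θ * ((k : ℝ) + 1) ^ 2 * y by ring]
    field_simp
  · have hy' : τ / 2 < y := hy
    have h3 := Real.sin_sq_le_one (((k : ℝ) + 1) * x)
    rw [Real.norm_eq_abs, abs_of_nonneg (by positivity), mul_assoc θ 2]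
    calc _ ≤ θ * (2 * 1 * Real.exp (-(θ * (τ / 2) * ((k : ℝ) + 1) ^ 2))) := by gcongr
      _ = _ := by ring

/-- The one-dimensional heat kernel profile, as a function of time, away from the origin. -/
def heatKernelTerm (θ y τ : ℝ) : ℝ :=
  if y = 0 then 0 else Real.exp (-(y ^ 2 / (θ * τ))) / √τ

lemma abs_heatKernelTerm_le {θ y τ T : ℝ} (hθ : 0 < θ) (hτ : 0 < τ) (hT : τ ≤ T) :
    |heatKernelTerm θ y τ| ≤ 7 * θ ^ 2 * √T * τ * (1 / y ^ 4) := by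
  unfold heatKernelTerm
  split_ifs with hy
  · simp [hy]
  · have h := exp_neg_div_le (c := θ * τ) (by positivity) hy
    have hs : √τ ≤ √T := Real.sqrt_le_sqrt hT
    have hs0 : 0 < √τ := Real.sqrt_pos.2 hτ
    have hy4 : 0 < y ^ 4 := by positivity
    rw [abs_of_nonneg (by positivity), div_le_iff₀ hs0]
    refine h.trans ?_
    calc 2 * (θ * τ) ^ 2 / y ^ 4 = 2 * θ ^ 2 * (√τ * √τ) * τ * (1 / y ^ 4) := by
          rw [Real.mul_self_sqrt hτ.le]
          ring
      _ ≤ 7 * θ ^ 2 * (√T * √τ) * τ * (1 / y ^ 4) := by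
          gcongr
          norm_num
      _ = _ := by ring

lemma abs_heatKernelTerm_sub_le {θ y τ τ' T : ℝ} (hθ : 0 < θ) (hτ : τ ∈ Set.Ioc 0 T)
    (hτ' : τ' ∈ Set.Ioc 0 T) :
    |heatKernelTerm θ y τ - heatKernelTerm θ y τ'| ≤ 7 * θ ^ 2 * √T * |τ - τ'| * (1 / y ^ 4) := by
  by_cases hy : y = 0
  · simp [heatKernelTerm, hy]
  have hd : ∀ t ∈ Set.Ioc 0 T, HasDerivWithinAt (heatKernelTerm θ y)
      (Real.exp (-(y ^ 2 / (θ * t))) * (y ^ 2 / (θ * t) - 1 / 2) / (t * √t)) (Set.Ioc 0 T) t := by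
    intro t ht
    have ht0 : 0 < t := ht.1
    have hs0 : 0 < √t := Real.sqrt_pos.2 ht0
    have h1 : HasDerivAt (fun t : ℝ => -(y ^ 2 / θ * t⁻¹)) (-(y ^ 2 / θ * (-(t ^ 2)⁻¹))) t :=
      ((hasDerivAt_inv ht0.ne').const_mul _).neg
    have h2 := h1.exp.div (Real.hasDerivAt_sqrt ht0.ne') hs0.ne'
    have e : heatKernelTerm θ y = (fun t : ℝ => Real.exp (-(y ^ 2 / θ * t⁻¹))) / fun t => √t := by
      ext t
      simp only [heatKernelTerm, hy, if_false, Pi.div_apply]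
      congr 3
      rw [← div_eq_mul_inv, div_div]
    rw [e]
    refine (h2.congr_deriv ?_).hasDerivWithinAt
    have e2 : y ^ 2 / θ * t⁻¹ = y ^ 2 / (θ * t) := by rw [← div_eq_mul_inv, div_div]
    have hst : √t ^ 2 = t := Real.sq_sqrt ht0.le
    rw [e2]
    field_simp
    simp only [hst]
    field_simp
    try ring
  have hb : ∀ t ∈ Set.Ioc 0 T,
      ‖Real.exp (-(y ^ 2 / (θ * t))) * (y ^ 2 / (θ * t) - 1 / 2) / (t * √t)‖
        ≤ 7 * θ ^ 2 * √T * (1 / y ^ 4) := by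
    intro t ht
    have ht0 : 0 < t := ht.1
    have hs0 : 0 < √t := Real.sqrt_pos.2 ht0
    set w := y ^ 2 / (θ * t) with hw
    have hw0 : 0 < w := by positivity
    have h3 := Real.pow_div_factorial_le_exp w hw0.le 3
    have h2 := Real.pow_div_factorial_le_exp w hw0.le 2
    have hA : Real.exp (-w) * (w + 1 / 2) ≤ 7 / w ^ 2 := by
      rw [Real.exp_neg, le_div_iff₀ (by positivity), ← div_eq_inv_mul, div_mul_eq_mul_div,
        div_le_iff₀ (Real.exp_pos _)]
      norm_num [Nat.factorial] at h2 h3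
      nlinarith
    have hab : |w - 1 / 2| ≤ w + 1 / 2 := by
      rw [abs_le]
      constructor <;> linarith
    rw [norm_div, norm_mul, Real.norm_eq_abs, Real.norm_eq_abs, Real.norm_eq_abs,
      abs_of_pos (Real.exp_pos _), abs_of_pos (by positivity : 0 < t * √t),
      div_le_iff₀ (by positivity)]
    calc Real.exp (-w) * |w - 1 / 2| ≤ Real.exp (-w) * (w + 1 / 2) := by gcongr
      _ ≤ 7 / w ^ 2 := hA
      _ = 7 * θ ^ 2 * (√t * √t) * (1 / y ^ 4) * t := by
        rw [Real.mul_self_sqrt ht0.le, hw]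
        field_simp
      _ ≤ 7 * θ ^ 2 * (√T * √t) * (1 / y ^ 4) * t := by
        gcongr
        exact ht.2
      _ = _ := by ring
  have := (convex_Ioc (0 : ℝ) T).norm_image_sub_le_of_norm_hasDerivWithin_le hd hb hτ' hτ
  rw [Real.norm_eq_abs, Real.norm_eq_abs] at this
  refine this.trans (le_of_eq (by ring))

/-- The regular part of the time derivative of `heatSeries`. -/
def heatSeriesRegularDeriv (θ x τ : ℝ) : ℝ :=
  √(π * θ) / 2 * ∑' n : ℤ, (heatKernelTerm θ (π * n) τ - heatKernelTerm θ (π * n - x) τ)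

lemma hasDerivAt_heatSeries {θ x τ : ℝ} (hθ : 0 < θ) (hx : x ∈ Set.Ioo 0 π) (hτ : 0 < τ) :
    HasDerivAt (heatSeries θ x) (√(π * θ) * (1 / (2 * √τ)) + heatSeriesRegularDeriv θ x τ) τ := by
  have hπ := Real.pi_pos
  refine (hasDerivAt_heatSeries_series hθ hτ).congr_deriv ?_
  have hc : 0 < θ * τ := by positivity
  have hs0 : 0 < √τ := Real.sqrt_pos.2 hτ
  rw [tsum_mul_left, tsum_sin_sq_mul_exp hc hx]
  have e1 : θ * (√(π / (θ * τ)) / 2) = √(π * θ) / 2 * (1 / √τ) := by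
    have : π / (θ * τ) = (π * θ) / (θ ^ 2 * τ) := by field_simp
    rw [this, Real.sqrt_div (by positivity), Real.sqrt_mul (by positivity) τ, Real.sqrt_sq hθ.le]
    field_simp
  have hterm : ∀ n : ℤ, 1 / √τ * (Real.exp (-((π * n) ^ 2 / (θ * τ)))
      - Real.exp (-((π * n - x) ^ 2 / (θ * τ))))
      = (if n = 0 then 1 / √τ else 0)
        + (heatKernelTerm θ (π * n) τ - heatKernelTerm θ (π * n - x) τ) := by
    intro n
    rw [heatKernelTerm, heatKernelTerm, if_neg (pi_mul_int_sub_ne_zero hx n)]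
    by_cases hn : n = 0
    · simp [hn]
      ring
    · have : π * (n : ℝ) ≠ 0 := mul_ne_zero hπ.ne' (by exact_mod_cast hn)
      simp only [hn, this, if_false]
      ring
  have hsum : Summable fun n : ℤ =>
      (heatKernelTerm θ (π * n) τ - heatKernelTerm θ (π * n - x) τ) := by
    have s0 := summable_inv_pi_mul_sub_pow_four 0
    simp only [sub_zero] at s0
    exact (Summable.of_norm_bounded (s0.mul_left _) fun n => abs_heatKernelTerm_le hθ hτ le_rfl).sub
      (Summable.of_norm_bounded ((summable_inv_pi_mul_sub_pow_four x).mul_left _) fun n =>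
        abs_heatKernelTerm_le hθ hτ le_rfl)
  rw [← mul_assoc, e1, mul_assoc, ← tsum_mul_left, tsum_congr hterm,
    (hasSum_ite_eq (0 : ℤ) _).summable.tsum_add hsum, tsum_ite_eq, heatSeriesRegularDeriv]
  ring

lemma exists_heatSeriesRegularDeriv_bounds {θ : ℝ} (hθ : 0 < θ) (x T : ℝ) :
    ∃ L : ℝ, 0 ≤ L ∧ (∀ τ ∈ Set.Ioc 0 T, |heatSeriesRegularDeriv θ x τ| ≤ L * τ) ∧
      ∀ τ ∈ Set.Ioc 0 T, ∀ τ' ∈ Set.Ioc 0 T,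
        |heatSeriesRegularDeriv θ x τ - heatSeriesRegularDeriv θ x τ'| ≤ L * |τ - τ'| := by
  have s0 := summable_inv_pi_mul_sub_pow_four 0
  simp only [sub_zero] at s0
  have s1 := summable_inv_pi_mul_sub_pow_four x
  set S := ∑' n : ℤ, (1 / (π * n) ^ 4 + 1 / (π * n - x) ^ 4) with hS
  have hS0 : 0 ≤ S := tsum_nonneg fun n => by positivity
  have hsum := (s0.add s1).hasSum
  have hsm : ∀ τ ∈ Set.Ioc 0 T, Summable fun n : ℤ =>
      (heatKernelTerm θ (π * n) τ - heatKernelTerm θ (π * n - x) τ) := fun τ hτ =>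
    (Summable.of_norm_bounded (s0.mul_left _) fun n => abs_heatKernelTerm_le hθ hτ.1 le_rfl).sub
      (Summable.of_norm_bounded (s1.mul_left _) fun n => abs_heatKernelTerm_le hθ hτ.1 le_rfl)
  refine ⟨√(π * θ) / 2 * (7 * θ ^ 2 * √T * S), by positivity, fun τ hτ => ?_, fun τ hτ τ' hτ' => ?_⟩
  · rw [heatSeriesRegularDeriv, abs_mul, abs_of_nonneg (by positivity), mul_assoc]
    gcongr
    have := tsum_of_norm_bounded (f := fun n : ℤ =>
      (heatKernelTerm θ (π * n) τ - heatKernelTerm θ (π * n - x) τ))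
      (hsum.mul_left (7 * θ ^ 2 * √T * τ)) fun n => by
        rw [mul_add]
        exact (norm_sub_le _ _).trans (add_le_add (abs_heatKernelTerm_le hθ hτ.1 hτ.2)
          (abs_heatKernelTerm_le hθ hτ.1 hτ.2))
    refine this.trans (le_of_eq ?_)
    ring
  · rw [heatSeriesRegularDeriv, heatSeriesRegularDeriv, ← mul_sub,
      ← (hsm τ hτ).tsum_sub (hsm τ' hτ'), abs_mul, abs_of_nonneg (by positivity), mul_assoc]
    gcongr
    have := tsum_of_norm_bounded (f := fun n : ℤ =>
      (heatKernelTerm θ (π * n) τ - heatKernelTerm θ (π * n - x) τ)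
        - (heatKernelTerm θ (π * n) τ' - heatKernelTerm θ (π * n - x) τ'))
      (hsum.mul_left (7 * θ ^ 2 * √T * |τ - τ'|)) fun n => by
        rw [mul_add, sub_sub_sub_comm]
        exact (norm_sub_le _ _).trans (add_le_add (abs_heatKernelTerm_sub_le hθ hτ hτ')
          (abs_heatKernelTerm_sub_le hθ hτ hτ'))
    refine this.trans (le_of_eq ?_)
    ring

/-- Short-time expansion of `heatSeries`: a square root plus a remainder with
bounded second differences. -/
lemma exists_heatSeries_expansion {θ x : ℝ} (hθ : 0 < θ) (hx : x ∈ Set.Ioo 0 π) (T : ℝ) :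
    ∃ (L : ℝ) (R : ℝ → ℝ), 0 ≤ L ∧ (∀ τ, heatSeries θ x τ = √(π * θ) * √τ + R τ) ∧ R 0 = 0 ∧
      (∀ h, 0 ≤ h → h ≤ T → |R h| ≤ L * h ^ 2) ∧
      ∀ τ h, 0 ≤ τ → 0 ≤ h → τ + 2 * h ≤ T → |R (τ + 2 * h) - 2 * R (τ + h) + R τ| ≤ L * h ^ 2 := by
  obtain ⟨L, hL, h1, h2⟩ := exists_heatSeriesRegularDeriv_bounds hθ x T
  set R : ℝ → ℝ := fun τ => heatSeries θ x τ - √(π * θ) * √τ with hR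
  have hR0 : R 0 = 0 := by simp [hR, heatSeries_zero]
  have hRc : ContinuousOn R (Set.Ici 0) :=
    (continuousOn_heatSeries hθ x).sub (by fun_prop)
  have hRd : ∀ τ, 0 < τ → HasDerivAt R (heatSeriesRegularDeriv θ x τ) τ := fun τ hτ => by
    refine ((hasDerivAt_heatSeries hθ hx hτ).sub
      ((Real.hasDerivAt_sqrt hτ.ne').const_mul _)).congr_deriv ?_
    ring
  refine ⟨L, R, hL, fun τ => by simp [hR], hR0, fun h h0 hT => ?_, fun τ h hτ h0 hT => ?_⟩
  · rcases h0.eq_or_lt with rfl | hpos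
    · simp [hR0]
    obtain ⟨c, hc, hce⟩ := exists_hasDerivAt_eq_slope R (heatSeriesRegularDeriv θ x) hpos
      (hRc.mono fun t ht => ht.1) fun t ht => hRd t ht.1
    have hb := h1 c ⟨hc.1, hc.2.le.trans hT⟩
    rw [hce, hR0, sub_zero, sub_zero, abs_div, abs_of_pos hpos, div_le_iff₀ hpos] at hb
    calc |R h| ≤ L * c * h := hb
      _ ≤ L * h * h := by
        gcongr
        exact hc.2.le
      _ = _ := by ring
  · rcases h0.eq_or_lt with rfl | hpos
    · simp
      linarith [abs_nonneg (R τ)]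
    obtain ⟨c, hc, hce⟩ := exists_hasDerivAt_eq_slope (fun s => R (s + h) - R s)
      (fun s => heatSeriesRegularDeriv θ x (s + h) - heatSeriesRegularDeriv θ x s)
      (show τ < τ + h by linarith)
      ((hRc.comp (by fun_prop) fun t ht => by
          have := ht.1
          simp only [Set.mem_Ici]
          linarith).sub (hRc.mono fun t ht => hτ.trans ht.1))
      fun t ht => by
        have ht0 : 0 < t := hτ.trans_lt ht.1
        exact ((hRd (t + h) (by linarith)).comp_add_const t h).sub (hRd t ht0)
    have hc0 : 0 < c := hτ.trans_lt hc.1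
    have hb := h2 (c + h) ⟨by linarith, by linarith [hc.2]⟩ c ⟨hc0, by linarith [hc.2]⟩
    rw [hce, abs_div] at hb
    simp only [add_sub_cancel_left, abs_of_pos hpos] at hb
    rw [div_le_iff₀ hpos] at hb
    calc _ = |R (τ + h + h) - R (τ + h) - (R (τ + h) - R τ)| := by
          congr 1
          rw [show τ + h + h = τ + 2 * h by ring]
          ring
      _ ≤ L * h * h := hb
      _ = _ := by ring

end HeatSeries

section FieldToFamily

lemma integral_sq_gaussianReal_zero (v : ℝ≥0) : ∫ z, z ^ 2 ∂(gaussianReal 0 v) = v := by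
  have h := variance_eq_sub (memLp_id_gaussianReal (μ := 0) (v := v) 2)
  simp only [variance_id_gaussianReal, Pi.pow_apply, id_eq, integral_id_gaussianReal] at h
  simpa using h.symm

variable {Ω : Type*} [MeasurableSpace Ω] {P : Measure Ω} {u : ℝ → Ω → ℝ} {S : Set ℝ}
  {C : ℝ → ℝ → ℝ}

lemma IsCenteredGaussianField.map_eq (hu : IsCenteredGaussianField P u S C) {s : ℝ} (hs : s ∈ S) :
    P.map (u s) = gaussianReal 0 (C s s).toNNReal := by
  simpa using hu 1 (fun _ => s) (fun _ => hs) fun _ => 1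

lemma IsCenteredGaussianField.map_add_eq (hu : IsCenteredGaussianField P u S C)
    (hsymm : ∀ s ∈ S, ∀ t ∈ S, C s t = C t s) {s t : ℝ} (hs : s ∈ S) (ht : t ∈ S) :
    P.map (fun ω => u s ω + u t ω) = gaussianReal 0 (C s s + 2 * C s t + C t t).toNNReal := by
  have h := hu 2 ![s, t] (fun i => by fin_cases i <;> simpa) fun _ => 1
  simp only [Fin.sum_univ_two, Matrix.cons_val_zero, Matrix.cons_val_one, one_mul] at h
  rw [h, hsymm t ht s hs]
  congr 2
  ring

lemma IsCenteredGaussianField.aemeasurable (hu : IsCenteredGaussianField P u S C) {s : ℝ}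
    (hs : s ∈ S) : AEMeasurable (u s) P := by
  by_contra h
  have h1 := hu.map_eq hs
  rw [Measure.map_of_not_aemeasurable h] at h1
  exact IsProbabilityMeasure.ne_zero _ h1.symm

lemma integral_sq_of_map_eq {X : Ω → ℝ} {v : ℝ} (hX : AEMeasurable X P) (hv : 0 ≤ v)
    (h : P.map X = gaussianReal 0 v.toNNReal) : ∫ ω, X ω ^ 2 ∂P = v := by
  rw [← Real.coe_toNNReal v hv, ← integral_sq_gaussianReal_zero, ← h,
    integral_map hX (by fun_prop)]

/-- Finitely many values of a centered Gaussian field with nonnegative covariances. -/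
lemma IsCenteredGaussianField.family {ι : Type*} [Fintype ι] (hu : IsCenteredGaussianField P u S C)
    (hsymm : ∀ s ∈ S, ∀ t ∈ S, C s t = C t s) (hnonneg : ∀ s ∈ S, ∀ t ∈ S, 0 ≤ C s t)
    {t : ι → ℝ} (ht : ∀ i, t i ∈ S) :
    IsCenteredGaussianFamily P (fun i => u (t i)) fun i j => C (t i) (t j) := by
  have hm : AEMeasurable (fun ω i => u (t i) ω) P :=
    aemeasurable_pi_lambda _ fun i => hu.aemeasurable (ht i)
  have hg : HasGaussianLaw (fun ω i => u (t i) ω) P := by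
    refine ⟨isGaussian_of_map_eq_gaussianReal fun L => ⟨0, ?_⟩⟩
    classical
    let e := Fintype.equivFin ι
    have h := hu (Fintype.card ι) (fun i => t (e.symm i)) (fun i => ht _)
      (fun i => L (Pi.single (e.symm i) 1))
    refine ⟨_, Eq.trans ?_ h⟩
    rw [AEMeasurable.map_map_of_aemeasurable (by fun_prop) hm]
    congr 1
    ext ω
    rw [Function.comp_apply, e.symm.sum_comp (fun i => L (Pi.single i 1) * u (t i) ω)]
    conv_lhs => rw [← ContinuousLinearMap.coe_coe, LinearMap.pi_apply_eq_sum_univ]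
    simp only [smul_eq_mul, ContinuousLinearMap.coe_coe]
    refine Finset.sum_congr rfl fun i _ => ?_
    rw [mul_comm]
    congr 2
    ext j
    simp [Pi.single_apply, eq_comm]
  have hmem : ∀ i, MemLp (u (t i)) 2 P := fun i => (hg.eval i).memLp (by simp)
  have hsq : ∀ i, ∫ ω, u (t i) ω ^ 2 ∂P = C (t i) (t i) := fun i =>
    integral_sq_of_map_eq (hu.aemeasurable (ht i)) (hnonneg _ (ht i) _ (ht i)) (hu.map_eq (ht i))
  refine ⟨hg, fun i => ?_, fun i j => ?_⟩
  · have h : ∫ z, z ∂(P.map (u (t i))) = 0 := by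
      rw [hu.map_eq (ht i), integral_id_gaussianReal]
    rwa [integral_map (hu.aemeasurable (ht i)) (by fun_prop)] at h
  · have h := integral_sq_of_map_eq ((hu.aemeasurable (ht i)).add (hu.aemeasurable (ht j)))
      (by
        have := hnonneg _ (ht i) _ (ht i)
        have := hnonneg _ (ht i) _ (ht j)
        have := hnonneg _ (ht j) _ (ht j)
        positivity) (hu.map_add_eq hsymm (ht i) (ht j))
    have h2 : ∫ ω, (u (t i) + u (t j)) ω ^ 2 ∂P
        = ∫ ω, u (t i) ω ^ 2 + 2 * (u (t i) ω * u (t j) ω) + u (t j) ω ^ 2 ∂P := by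
      congr 1 with ω
      rw [Pi.add_apply]
      ring
    have hij : Integrable (fun ω => u (t i) ω * u (t j) ω) P := (hmem i).integrable_mul (hmem j)
    have h3 : Integrable (fun ω => u (t i) ω ^ 2 + 2 * (u (t i) ω * u (t j) ω)) P :=
      (hmem i).integrable_sq.add (hij.const_mul 2)
    rw [h2, integral_add h3 (hmem j).integrable_sq,
      integral_add (hmem i).integrable_sq (hij.const_mul 2), integral_const_mul, hsq, hsq] at h
    linarith

end FieldToFamily

section Increments

variable {Ω : Type*} [MeasurableSpace Ω] {P : Measure Ω} [IsFiniteMeasure P]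

/-- Scaled consecutive increments of a centered Gaussian family. -/
lemma IsCenteredGaussianFamily.increments {n : ℕ} {Y : Fin (n + 1) → Ω → ℝ}
    {ρ : Fin (n + 1) → Fin (n + 1) → ℝ} (h : IsCenteredGaussianFamily P Y ρ) (a : ℝ) :
    IsCenteredGaussianFamily P (fun (i : Fin n) ω => a * (Y i.succ ω - Y i.castSucc ω))
      fun i j => a ^ 2 * (ρ i.succ j.succ - ρ i.succ j.castSucc - ρ i.castSucc j.succ
        + ρ i.castSucc j.castSucc) := by
  have hmem : ∀ i, MemLp (Y i) 2 P := fun i => (h.gauss.eval i).memLp (by simp)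
  have hInt : ∀ i j, Integrable (fun ω => Y i ω * Y j ω) P := fun i j =>
    (hmem i).integrable_mul (hmem j)
  refine ⟨?_, fun i => ?_, fun i j => ?_⟩
  · exact h.gauss.map_fun (ContinuousLinearMap.pi fun i : Fin n =>
      a • (ContinuousLinearMap.proj (R := ℝ) (φ := fun _ => ℝ) i.succ
        - ContinuousLinearMap.proj i.castSucc))
  · rw [integral_const_mul, integral_sub ((hmem _).integrable one_le_two')
      ((hmem _).integrable one_le_two'), h.mean, h.mean]
    simp
  · have e : ∀ ω, a * (Y i.succ ω - Y i.castSucc ω) * (a * (Y j.succ ω - Y j.castSucc ω))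
        = a ^ 2 * (Y i.succ ω * Y j.succ ω - Y i.succ ω * Y j.castSucc ω
          - Y i.castSucc ω * Y j.succ ω + Y i.castSucc ω * Y j.castSucc ω) := fun ω => by ring
    simp_rw [e]
    have h1 := (hInt i.succ j.succ).sub' (hInt i.succ j.castSucc)
    have h2 := h1.sub' (hInt i.castSucc j.succ)
    rw [integral_const_mul, integral_add h2 (hInt _ _), integral_sub h1 (hInt _ _),
      integral_sub (hInt _ _) (hInt _ _)]
    simp_rw [h.cov]

end Increments

section HeatCovariance

variable {θ σ x : ℝ}

lemma heatCovTime_symm (s t : ℝ) : heatCovTime θ σ x s t = heatCovTime θ σ x t s := by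
  simp only [heatCovTime, abs_sub_comm t s, add_comm t s]

lemma heatCovTime_nonneg (hθ : 0 < θ) {s t : ℝ} (hs : 0 ≤ s) (ht : 0 ≤ t) :
    0 ≤ heatCovTime θ σ x s t := by
  refine mul_nonneg (by positivity) (tsum_nonneg fun k => mul_nonneg (by positivity) ?_)
  rw [sub_nonneg, Real.exp_le_exp, neg_le_neg_iff]
  gcongr
  rw [abs_le]
  constructor <;> linarith

lemma heatCovTime_eq (hθ : 0 < θ) {s t : ℝ} (hs : 0 ≤ s) (ht : 0 ≤ t) :
    heatCovTime θ σ x s t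
      = σ ^ 2 / (θ * π) / 2 * (heatSeries θ x (s + t) - heatSeries θ x |s - t|) := by
  have h := (summable_heatSeries (x := x) hθ (add_nonneg hs ht)).tsum_sub
    (summable_heatSeries (x := x) hθ (abs_nonneg (s - t)))
  rw [heatCovTime, heatSeries, heatSeries, ← h, div_mul_eq_mul_div _ (2 : ℝ), mul_div_assoc,
    ← tsum_div_const, abs_sub_comm, add_comm]
  congr 1
  refine tsum_congr fun k => ?_
  ring

/-- Correlation of the increments, at distance `m`, of a process with variogram `√τ`. -/
def sqrtCorr (m : ℕ) : ℝ := (√((m : ℝ) + 1) + √|(m : ℝ) - 1| - 2 * √m) / 2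

lemma abs_sqrt_second_diff_le {a s h : ℝ} (ha : 0 < a) (hs : a ≤ s) (hh : 0 ≤ h) :
    |√(s + 2 * h) - 2 * √(s + h) + √s| ≤ 1 / (4 * (a * √a)) * h ^ 2 := by
  have hs0 : 0 < s := ha.trans_le hs
  have p0 : 0 < √s := Real.sqrt_pos.2 hs0
  set p := √s
  have hpq : p ≤ √(s + h) := Real.sqrt_le_sqrt (by linarith)
  set q := √(s + h)
  have hqr : q ≤ √(s + 2 * h) := Real.sqrt_le_sqrt (by linarith)
  set r := √(s + 2 * h)
  have hp2 : p ^ 2 = s := Real.sq_sqrt hs0.le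
  have hq2 : q ^ 2 = s + h := Real.sq_sqrt (by linarith)
  have hr2 : r ^ 2 = s + 2 * h := Real.sq_sqrt (by linarith)
  have e1 : r - q = h / (r + q) := by
    rw [eq_div_iff (by linarith)]
    nlinarith
  have e2 : q - p = h / (q + p) := by
    rw [eq_div_iff (by linarith)]
    nlinarith
  have e3 : r - p = 2 * h / (r + p) := by
    rw [eq_div_iff (by linarith)]
    nlinarith
  have e : r - 2 * q + p = - (2 * h ^ 2 / ((r + p) * ((r + q) * (q + p)))) := by
    have : r - 2 * q + p = (r - q) - (q - p) := by ring
    rw [this, e1, e2, div_sub_div _ _ (by linarith) (by linarith),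
      show h * (q + p) - (r + q) * h = - (h * (r - p)) by ring, e3]
    field_simp
  have hap : √a ≤ p := Real.sqrt_le_sqrt hs
  have haa : a * √a = √a * (√a * √a) := by
    rw [Real.mul_self_sqrt ha.le]
    ring
  have hsa : 0 < √a := Real.sqrt_pos.2 ha
  rw [e, abs_neg, abs_of_nonneg (by positivity)]
  calc 2 * h ^ 2 / ((r + p) * ((r + q) * (q + p)))
      ≤ 2 * h ^ 2 / ((√a + √a) * ((√a + √a) * (√a + √a))) := by
        gcongr <;> linarith
    _ = _ := by
        rw [haa]
        field_simp
        ring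

/-- Covariances of increments over a uniform grid of the heat equation at a fixed point. -/
lemma exists_heatCovTime_increment_le (hθ : 0 < θ) (hσ : 0 < σ) (hx : x ∈ Set.Ioo 0 π)
    {c d : ℝ} (hc : 0 < c) :
    ∃ K : ℝ, 0 ≤ K ∧ ∀ (s t h : ℝ) (m : ℕ), c ≤ s → c ≤ t → 0 < h → s + h ≤ d → t + h ≤ d →
      |s - t| = m * h →
      |heatCovTime θ σ x (s + h) (t + h) - heatCovTime θ σ x (s + h) t
        - heatCovTime θ σ x s (t + h) + heatCovTime θ σ x s t
        - σ ^ 2 / (θ * π) * √(π * θ) * √h * sqrtCorr m| ≤ K * h ^ 2 := by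
  obtain ⟨L, R, hL, hΦ, hR0, hR1, hR2⟩ := exists_heatSeries_expansion hθ hx (2 * d)
  set κ := σ ^ 2 / (θ * π) with hκ
  have hκ0 : 0 < κ := by positivity
  have hc2 : 0 < 2 * c := by positivity
  set A := 1 / (4 * ((2 * c) * √(2 * c))) with hA
  have hA0 : 0 ≤ A := by positivity
  refine ⟨κ / 2 * (√(π * θ) * A + L + 2 * L), by positivity,
    fun s t h m hs ht hh hsd htd hm => ?_⟩
  wlog hst : t ≤ s generalizing s t with H
  · have h' := H t s ht hs htd hsd (by rwa [abs_sub_comm]) (le_of_not_ge hst)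
    rw [heatCovTime_symm (t + h) (s + h), heatCovTime_symm (t + h) s,
      heatCovTime_symm t (s + h), heatCovTime_symm t s] at h'
    convert h' using 2
    ring
  rw [abs_of_nonneg (by linarith)] at hm
  have hs' : s = t + m * h := by linarith
  have hmain : heatCovTime θ σ x (s + h) (t + h) - heatCovTime θ σ x (s + h) t
        - heatCovTime θ σ x s (t + h) + heatCovTime θ σ x s t
      - κ * √(π * θ) * √h * sqrtCorr m
      = κ / 2 * (√(π * θ) * (√(s + t + 2 * h) - 2 * √(s + t + h) + √(s + t))
        + (R (s + t + 2 * h) - 2 * R (s + t + h) + R (s + t))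
        + (R (m * h + h) - 2 * R (m * h) + R (|(m : ℝ) - 1| * h))) := by
    have hm0 : (0 : ℝ) ≤ m := m.cast_nonneg
    have e1 : |s + h - (t + h)| = m * h := by
      rw [abs_of_nonneg] <;> nlinarith
    have e2 : |s + h - t| = m * h + h := by
      rw [abs_of_nonneg] <;> nlinarith
    have e3 : |s - (t + h)| = |(m : ℝ) - 1| * h := by
      rw [show s - (t + h) = ((m : ℝ) - 1) * h by linarith, abs_mul, abs_of_pos hh]
    have e4 : |s - t| = m * h := by
      rw [abs_of_nonneg] <;> nlinarith
    have q1 : √((m : ℝ) * h + h) = √((m : ℝ) + 1) * √h := by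
      rw [← Real.sqrt_mul (by positivity)]
      ring_nf
    rw [heatCovTime_eq hθ (by linarith) (by linarith), heatCovTime_eq hθ (by linarith) (by linarith),
      heatCovTime_eq hθ (by linarith) (by linarith), heatCovTime_eq hθ (by linarith) (by linarith),
      ← hκ, e1, e2, e3, e4, show s + h + (t + h) = s + t + 2 * h by ring,
      show s + h + t = s + t + h by ring, show s + (t + h) = s + t + h by ring]
    simp only [hΦ, q1, Real.sqrt_mul hm0, Real.sqrt_mul (abs_nonneg ((m : ℝ) - 1)), sqrtCorr]
    ring
  rw [hmain, abs_mul, abs_of_pos (by positivity : (0 : ℝ) < κ / 2), mul_assoc]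
  refine mul_le_mul_of_nonneg_left ?_ (by positivity)
  have b1 := abs_sqrt_second_diff_le hc2 (show 2 * c ≤ s + t by linarith) hh.le
  have b2 := hR2 (s + t) h (by linarith) hh.le (by linarith)
  have b3 : |R (m * h + h) - 2 * R (m * h) + R (|(m : ℝ) - 1| * h)| ≤ 2 * L * h ^ 2 := by
    rcases Nat.eq_zero_or_pos m with rfl | hmpos
    · have := hR1 h hh.le (by linarith)
      simp only [Nat.cast_zero, zero_mul, zero_add, hR0, zero_sub, abs_neg, abs_one, one_mul,
        mul_zero, sub_zero]
      rw [← two_mul, abs_mul, abs_two]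
      linarith
    · have hm1 : (1 : ℝ) ≤ m := by exact_mod_cast hmpos
      have := hR2 (((m : ℝ) - 1) * h) h (by nlinarith) hh.le (by nlinarith)
      rw [abs_of_nonneg (by linarith : (0 : ℝ) ≤ (m : ℝ) - 1)]
      rw [show ((m : ℝ) - 1) * h + 2 * h = m * h + h by ring,
        show ((m : ℝ) - 1) * h + h = m * h by ring] at this
      nlinarith
  calc _ ≤ |√(π * θ) * (√(s + t + 2 * h) - 2 * √(s + t + h) + √(s + t))|
        + |R (s + t + 2 * h) - 2 * R (s + t + h) + R (s + t)|
        + |R (m * h + h) - 2 * R (m * h) + R (|(m : ℝ) - 1| * h)| := abs_add_three _ _ _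
    _ ≤ √(π * θ) * (A * h ^ 2) + L * h ^ 2 + 2 * L * h ^ 2 := by
        rw [abs_mul, abs_of_nonneg (Real.sqrt_nonneg (π * θ))]
        gcongr
    _ = _ := by ring

end HeatCovariance

/-- Normalized increments over the uniform grid form a Gaussian family whose covariance is
that of a process with variogram `√τ`, up to `O(n ^ (-3/2))`. -/
lemma exists_normalized_increments {Ω : Type*} [MeasurableSpace Ω] {P : Measure Ω}
    [IsProbabilityMeasure P] {θ σ x c d : ℝ} (hθ : 0 < θ) (hσ : 0 < σ) (hx : x ∈ Set.Ioo 0 π)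
    (hc : 0 < c) (hcd : c < d) {u : ℝ → Ω → ℝ}
    (hu : IsCenteredGaussianField P u (Set.Icc c d) (heatCovTime θ σ x)) :
    ∃ K : ℝ, 0 ≤ K ∧ ∀ n : ℕ, 0 < n → ∃ (a : ℝ) (ρ : Fin n → Fin n → ℝ),
      IsCenteredGaussianFamily P (fun (i : Fin n) ω =>
        a * (u (c + (d - c) * ((i : ℝ) + 1) / n) ω - u (c + (d - c) * (i : ℝ) / n) ω)) ρ ∧
      a ^ 4 = π * θ * n / (σ ^ 4 * (d - c)) ∧
      ∀ i j : Fin n, |ρ i j - sqrtCorr ((i : ℤ) - (j : ℤ)).natAbs| ≤ K / (n * √n) := by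
  obtain ⟨K, hK0, hK⟩ := exists_heatCovTime_increment_le (d := d) hθ hσ hx hc
  have hdc : 0 < d - c := sub_pos.2 hcd
  set κ := σ ^ 2 / (θ * π) with hκ
  have hκ0 : 0 < κ := by positivity
  have hsπ : 0 < √(π * θ) := Real.sqrt_pos.2 (by positivity)
  refine ⟨K * ((d - c) * √(d - c)) / (κ * √(π * θ)), by positivity, fun n hn => ?_⟩
  have hn0 : (0 : ℝ) < n := by exact_mod_cast hn
  have hsn : 0 < √(n : ℝ) := Real.sqrt_pos.2 hn0
  set h := (d - c) / n with hh
  have hh0 : 0 < h := by positivity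
  have hsh : 0 < √h := Real.sqrt_pos.2 hh0
  set v := κ * √(π * θ) * √h with hv
  have hv0 : 0 < v := by positivity
  set t : Fin (n + 1) → ℝ := fun i => c + (d - c) * (i : ℝ) / n with ht
  have htmem : ∀ i, t i ∈ Set.Icc c d := fun i => by
    have hi : (i : ℝ) ≤ n := by exact_mod_cast Nat.le_of_lt_succ i.2
    have h1 : (d - c) * (i : ℝ) / n ≤ d - c := by
      rw [div_le_iff₀ hn0]
      gcongr
    have h2 : 0 ≤ (d - c) * (i : ℝ) / n := by positivity
    exact ⟨by simp only [ht]; linarith, by simp only [ht]; linarith⟩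
  have hts : ∀ i : Fin n, t i.succ = t i.castSucc + h := fun i => by
    simp only [ht, hh, Fin.val_succ, Fin.val_castSucc, Nat.cast_add, Nat.cast_one]
    ring
  have ha2 : (√v)⁻¹ ^ 2 = v⁻¹ := by rw [inv_pow, Real.sq_sqrt hv0.le]
  have hfam := (hu.family (fun s _ t _ => heatCovTime_symm s t)
    (fun s hs t ht => heatCovTime_nonneg hθ (hc.le.trans hs.1) (hc.le.trans ht.1))
    htmem).increments (√v)⁻¹
  have e : (fun (i : Fin n) ω => (√v)⁻¹ * (u (t i.succ) ω - u (t i.castSucc) ω)) =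
      fun (i : Fin n) ω =>
        (√v)⁻¹ * (u (c + (d - c) * ((i : ℝ) + 1) / n) ω - u (c + (d - c) * (i : ℝ) / n) ω) := by
    simp [ht]
  rw [e] at hfam
  refine ⟨(√v)⁻¹, _, hfam, ?_, fun i j => ?_⟩
  · rw [show (√v)⁻¹ ^ 4 = ((√v)⁻¹ ^ 2) ^ 2 by ring, ha2, inv_pow, hv, mul_pow, mul_pow,
      Real.sq_sqrt (by positivity), Real.sq_sqrt hh0.le, hκ, hh]
    field_simp
  · have hm : |t i.castSucc - t j.castSucc| = (((i : ℤ) - (j : ℤ)).natAbs : ℝ) * h := by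
      have : t i.castSucc - t j.castSucc = (((i : ℤ) - (j : ℤ) : ℤ) : ℝ) * h := by
        simp only [ht, hh, Fin.val_castSucc, Int.cast_sub, Int.cast_natCast]
        ring
      rw [this, abs_mul, abs_of_pos hh0, Nat.cast_natAbs, Int.cast_abs]
    have hb := hK (t i.castSucc) (t j.castSucc) h _ (htmem _).1 (htmem _).1 hh0
      (by rw [← hts]; exact (htmem _).2) (by rw [← hts]; exact (htmem _).2) hm
    rw [ha2, hts, hts, show ∀ y r : ℝ, v⁻¹ * y - r = (y - v * r) / v by
      intro y r; field_simp, abs_div, abs_of_pos hv0]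
    calc _ ≤ K * h ^ 2 / v := by gcongr
      _ = K * (h * √h) / (κ * √(π * θ)) := by
        rw [hv, div_eq_div_iff (by positivity) (by positivity),
          show h ^ 2 = h * (√h * √h) by rw [Real.mul_self_sqrt hh0.le]; ring]
        ring
      _ = _ := by
        rw [hh, Real.sqrt_div hdc.le]
        field_simp

section Correlations

lemma sqrtCorr_zero : sqrtCorr 0 = 1 := by
  simp [sqrtCorr]

lemma sqrtCorr_succ (m : ℕ) :
    sqrtCorr (m + 1) = (√((m : ℝ) + 2) - √((m : ℝ) + 1)) / 2 - (√((m : ℝ) + 1) - √m) / 2 := by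
  rw [sqrtCorr]
  push_cast
  rw [show (m : ℝ) + 1 + 1 = m + 2 by ring, add_sub_cancel_right, abs_of_nonneg m.cast_nonneg]
  ring

lemma sqrtCorr_succ_nonpos (m : ℕ) : sqrtCorr (m + 1) ≤ 0 := by
  rw [sqrtCorr_succ]
  have h0 := Real.sq_sqrt (m.cast_nonneg : (0 : ℝ) ≤ m)
  have h1 := Real.sq_sqrt (by positivity : (0 : ℝ) ≤ (m : ℝ) + 1)
  have h2 := Real.sq_sqrt (by positivity : (0 : ℝ) ≤ (m : ℝ) + 2)
  have p0 := Real.sqrt_nonneg (m : ℝ)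
  have p2 := Real.sqrt_nonneg ((m : ℝ) + 2)
  have p1 := Real.sqrt_nonneg ((m : ℝ) + 1)
  have : √((m : ℝ) + 2) + √m ≤ 2 * √((m : ℝ) + 1) := by
    refine abs_le_of_sq_le_sq' ?_ (by positivity) |>.2
    nlinarith [sq_nonneg (√((m : ℝ) + 2) - √m)]
  linarith

lemma sum_abs_sqrtCorr_succ_le (n : ℕ) : ∑ m ∈ Finset.range n, |sqrtCorr (m + 1)| ≤ 1 / 2 := by
  have h : ∑ m ∈ Finset.range n, |sqrtCorr (m + 1)|
      = 1 / 2 - (√((n : ℝ) + 1) - √n) / 2 := by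
    induction n with
    | zero => simp
    | succ n ih =>
      rw [Finset.sum_range_succ, ih, abs_of_nonpos (sqrtCorr_succ_nonpos n), sqrtCorr_succ]
      push_cast
      rw [show (n : ℝ) + 1 + 1 = n + 2 by ring]
      ring
  rw [h]
  have : √(n : ℝ) ≤ √((n : ℝ) + 1) := Real.sqrt_le_sqrt (by linarith)
  linarith

lemma summable_sqrtCorr_succ : Summable fun m => |sqrtCorr (m + 1)| :=
  summable_of_sum_range_le (fun _ => abs_nonneg _) sum_abs_sqrtCorr_succ_le

lemma abs_sqrtCorr_le_one (m : ℕ) : |sqrtCorr m| ≤ 1 := by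
  cases m with
  | zero => simp [sqrtCorr_zero]
  | succ m =>
    have := (Finset.single_le_sum (f := fun m => |sqrtCorr (m + 1)|) (fun _ _ => abs_nonneg _)
      (Finset.self_mem_range_succ m)).trans (sum_abs_sqrtCorr_succ_le (m + 1))
    linarith

end Correlations

section Toeplitz

/-- Double sums of a function of the distance between indices. -/
lemma sum_sum_natAbs_sub (f : ℕ → ℝ) (n : ℕ) :
    ∑ i ∈ Finset.range n, ∑ j ∈ Finset.range n, f ((i : ℤ) - (j : ℤ)).natAbs
      = ∑ k ∈ Finset.range n, (f 0 + 2 * ∑ m ∈ Finset.range k, f (m + 1)) := by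
  have key : ∀ n : ℕ, ∑ j ∈ Finset.range n, f ((n : ℤ) - (j : ℤ)).natAbs
      = ∑ m ∈ Finset.range n, f (m + 1) := fun n => by
    rw [← Finset.sum_range_reflect]
    refine Finset.sum_congr rfl fun j hj => ?_
    have := Finset.mem_range.1 hj
    congr 1
    omega
  induction n with
  | zero => simp
  | succ n ih =>
    rw [Finset.sum_range_succ (n := n) (f := fun k => f 0 + 2 * ∑ m ∈ Finset.range k, f (m + 1)),
      ← ih, Finset.sum_range_succ]
    simp_rw [Finset.sum_range_succ _ n]
    rw [Finset.sum_add_distrib, key]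
    have : ∑ i ∈ Finset.range n, f ((i : ℤ) - (n : ℤ)).natAbs
        = ∑ m ∈ Finset.range n, f (m + 1) := by
      rw [← key]
      refine Finset.sum_congr rfl fun j _ => ?_
      rw [← Int.natAbs_neg, neg_sub]
    rw [this]
    simp
    ring

lemma tendsto_inv_mul_sum_sum_natAbs_sub {f : ℕ → ℝ} (hf : Summable fun m => f (m + 1)) :
    Tendsto (fun n : ℕ => (1 / (n : ℝ)) * ∑ i : Fin n, ∑ j : Fin n, f ((i : ℤ) - (j : ℤ)).natAbs)
      atTop (𝓝 (f 0 + 2 * ∑' m, f (m + 1))) := by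
  have h := ((hf.hasSum.tendsto_sum_nat.const_mul 2).const_add (f 0)).cesaro
  refine h.congr fun n => ?_
  rw [← sum_sum_natAbs_sub, one_div, Finset.sum_range]
  congr 1
  refine Finset.sum_congr rfl fun i _ => ?_
  rw [Finset.sum_range]

lemma sum_natAbs_sub_le {f : ℕ → ℝ} {B : ℝ}
    (hB : ∀ n, ∑ m ∈ Finset.range n, f (m + 1) ≤ B) (n : ℕ) (i : Fin n) :
    ∑ j : Fin n, f ((i : ℤ) - (j : ℤ)).natAbs ≤ f 0 + 2 * B := by
  have h : ∀ i n : ℕ, i < n → ∑ j ∈ Finset.range n, f ((i : ℤ) - (j : ℤ)).natAbs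
      = f 0 + ∑ m ∈ Finset.range i, f (m + 1) + ∑ m ∈ Finset.range (n - 1 - i), f (m + 1) := by
    intro i n hin
    obtain ⟨k, rfl⟩ := Nat.exists_eq_add_of_lt hin
    rw [add_assoc, Finset.sum_range_add, Finset.sum_range_succ' _ k,
      ← Finset.sum_range_reflect (fun m => f (m + 1)) i]
    have e1 : ∑ j ∈ Finset.range i, f ((i : ℤ) - (j : ℤ)).natAbs
        = ∑ j ∈ Finset.range i, f (i - 1 - j + 1) := by
      refine Finset.sum_congr rfl fun j hj => ?_
      have := Finset.mem_range.1 hj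
      congr 1
      omega
    have e2 : ∑ j ∈ Finset.range k, f ((i : ℤ) - ((i + (j + 1) : ℕ) : ℤ)).natAbs
        = ∑ j ∈ Finset.range k, f (j + 1) := by
      refine Finset.sum_congr rfl fun j _ => ?_
      congr 1
      omega
    rw [e1, e2, show i + (k + 1) - 1 - i = k by omega]
    simp
    ring
  have h1 := h i n i.2
  rw [Finset.sum_range] at h1
  rw [h1]
  linarith [hB i, hB (n - 1 - i)]

end Toeplitz

section Perturbation

/-- Asymptotic variance coefficient of a fourth-power functional, as a function of the lag. -/
def quarticLagVariance (m : ℕ) : ℝ := 72 * sqrtCorr m ^ 2 + 24 * sqrtCorr m ^ 4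

lemma quarticLagVariance_nonneg (m : ℕ) : 0 ≤ quarticLagVariance m := by
  unfold quarticLagVariance
  positivity

lemma summable_quarticLagVariance_succ : Summable fun m => quarticLagVariance (m + 1) := by
  refine Summable.of_nonneg_of_le (fun m => quarticLagVariance_nonneg _) (fun m => ?_)
    (summable_sqrtCorr_succ.mul_left 96)
  have h0 := abs_nonneg (sqrtCorr (m + 1))
  have h1 := abs_sqrtCorr_le_one (m + 1)
  have h2 : |sqrtCorr (m + 1)| ^ 2 ≤ |sqrtCorr (m + 1)| := pow_le_of_le_one h0 h1 two_ne_zero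
  have h4 : |sqrtCorr (m + 1)| ^ 4 ≤ |sqrtCorr (m + 1)| := pow_le_of_le_one h0 h1 four_ne_zero
  rw [quarticLagVariance, ← sq_abs, ← (by decide : Even 4).pow_abs (sqrtCorr (m + 1))]
  linarith

/-- Asymptotic variance of the normalized fourth-power functional. -/
def quarticVariance : ℝ := quarticLagVariance 0 + 2 * ∑' m, quarticLagVariance (m + 1)

lemma quarticVariance_pos : 0 < quarticVariance := by
  have h : 0 ≤ ∑' m, quarticLagVariance (m + 1) := tsum_nonneg fun m => quarticLagVariance_nonneg _
  have h0 : quarticLagVariance 0 = 96 := by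
    norm_num [quarticLagVariance, sqrtCorr_zero]
  rw [quarticVariance, h0]
  positivity

lemma abs_sq_sub_sq_le {a b M ε : ℝ} (ha : |a| ≤ M) (hb : |b| ≤ M) (h : |a - b| ≤ ε) :
    |a ^ 2 - b ^ 2| ≤ 2 * M * ε := by
  rw [sq_sub_sq, abs_mul]
  have hM : 0 ≤ M := (abs_nonneg a).trans ha
  refine mul_le_mul ((abs_add_le a b).trans (by linarith)) h (abs_nonneg _) (by positivity)

lemma abs_quartic_coeff_sub_le {v w r r' M ε : ℝ} (hM : 1 ≤ M) (hw : |w| ≤ M)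
    (hr : |r| ≤ M) (hr' : |r'| ≤ M) (hvε : |v - 1| ≤ ε) (hwε : |w - 1| ≤ ε) (hrε : |r - r'| ≤ ε) :
    |(72 * v * w * r ^ 2 + 24 * r ^ 4) - (72 * r' ^ 2 + 24 * r' ^ 4)| ≤ 384 * M ^ 3 * ε := by
  have hε : 0 ≤ ε := (abs_nonneg _).trans hvε
  have hM0 : 0 ≤ M := by linarith
  have s1 := abs_sq_sub_sq_le hr hr' hrε
  have hr2 : r ^ 2 ≤ M ^ 2 := sq_le_sq' (abs_le.1 hr).1 (abs_le.1 hr).2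
  have hr2' : r' ^ 2 ≤ M ^ 2 := sq_le_sq' (abs_le.1 hr').1 (abs_le.1 hr').2
  have e : (72 * v * w * r ^ 2 + 24 * r ^ 4) - (72 * r' ^ 2 + 24 * r' ^ 4)
      = 72 * ((v - 1) * w * r ^ 2) + 72 * ((w - 1) * r ^ 2)
        + (72 + 24 * (r ^ 2 + r' ^ 2)) * (r ^ 2 - r' ^ 2) := by ring
  have t1 : |72 * ((v - 1) * w * r ^ 2)| ≤ 72 * (ε * M * M ^ 2) := by
    rw [abs_mul, abs_mul, abs_mul, abs_of_pos (by norm_num : (0 : ℝ) < 72),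
      abs_of_nonneg (sq_nonneg r)]
    gcongr
  have t2 : |72 * ((w - 1) * r ^ 2)| ≤ 72 * (ε * M ^ 2) := by
    rw [abs_mul, abs_mul, abs_of_pos (by norm_num : (0 : ℝ) < 72), abs_of_nonneg (sq_nonneg r)]
    gcongr
  have t3 : |(72 + 24 * (r ^ 2 + r' ^ 2)) * (r ^ 2 - r' ^ 2)|
      ≤ (72 + 24 * (M ^ 2 + M ^ 2)) * (2 * M * ε) := by
    rw [abs_mul, abs_of_nonneg (by positivity : 0 ≤ 72 + 24 * (r ^ 2 + r' ^ 2))]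
    gcongr
  rw [e]
  have p1 : M ≤ M ^ 3 := le_self_pow₀ hM (by norm_num)
  have p2 : M ^ 2 ≤ M ^ 3 := pow_le_pow_right₀ hM (by norm_num)
  calc _ ≤ 72 * (ε * M * M ^ 2) + 72 * (ε * M ^ 2) + (72 + 24 * (M ^ 2 + M ^ 2)) * (2 * M * ε) :=
        (abs_add_three _ _ _).trans (by linarith)
    _ = (168 * M ^ 3 + 72 * M ^ 2 + 144 * M) * ε := by ring
    _ ≤ (168 * M ^ 3 + 72 * M ^ 3 + 144 * M ^ 3) * ε := by gcongr
    _ = _ := by ring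

variable {n : ℕ} {ρ : Fin n → Fin n → ℝ} {K : ℝ}

lemma div_mul_sqrt_le_self (hn : 0 < n) (hK : 0 ≤ K) : K / (n * √n) ≤ K := by
  have h1 : (1 : ℝ) ≤ n := by exact_mod_cast hn
  refine div_le_self hK ?_
  have h2 : 1 ≤ √(n : ℝ) := Real.one_le_sqrt.2 h1
  nlinarith

lemma sum_abs_cov_le (hn : 0 < n) (hK : 0 ≤ K)
    (h : ∀ i j : Fin n, |ρ i j - sqrtCorr ((i : ℤ) - (j : ℤ)).natAbs| ≤ K / (n * √n))
    (i : Fin n) : ∑ j, |ρ i j| ≤ 2 + K := by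
  have h1 : (1 : ℝ) ≤ n := by exact_mod_cast hn
  have h2 : 1 ≤ √(n : ℝ) := Real.one_le_sqrt.2 h1
  have hs := sum_natAbs_sub_le (f := fun m => |sqrtCorr m|) sum_abs_sqrtCorr_succ_le n i
  simp only [sqrtCorr_zero, abs_one] at hs
  calc ∑ j, |ρ i j| ≤ ∑ j : Fin n, (|sqrtCorr ((i : ℤ) - (j : ℤ)).natAbs| + K / (n * √n)) := by
        refine Finset.sum_le_sum fun j _ => ?_
        have := abs_sub_abs_le_abs_sub (ρ i j) (sqrtCorr ((i : ℤ) - (j : ℤ)).natAbs)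
        linarith [h i j]
    _ = (∑ j : Fin n, |sqrtCorr ((i : ℤ) - (j : ℤ)).natAbs|) + K / √n := by
        rw [Finset.sum_add_distrib, Finset.sum_const, Finset.card_univ, Fintype.card_fin,
          nsmul_eq_mul]
        congr 1
        field_simp
    _ ≤ 2 + K := by
        have := div_le_self hK h2
        linarith

lemma abs_cov_le (hn : 0 < n) (hK : 0 ≤ K)
    (h : ∀ i j : Fin n, |ρ i j - sqrtCorr ((i : ℤ) - (j : ℤ)).natAbs| ≤ K / (n * √n))
    (i j : Fin n) : |ρ i j| ≤ 1 + K := by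
  have h1 := abs_sub_abs_le_abs_sub (ρ i j) (sqrtCorr ((i : ℤ) - (j : ℤ)).natAbs)
  linarith [h i j, div_mul_sqrt_le_self hn hK, abs_sqrtCorr_le_one ((i : ℤ) - (j : ℤ)).natAbs]

lemma abs_var_sub_one_le
    (h : ∀ i j : Fin n, |ρ i j - sqrtCorr ((i : ℤ) - (j : ℤ)).natAbs| ≤ K / (n * √n))
    (i : Fin n) : |ρ i i - 1| ≤ K / (n * √n) := by
  simpa [sqrtCorr_zero] using h i i

lemma abs_sum_quartic_coeff_sub_le (hn : 0 < n) (hK : 0 ≤ K)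
    (h : ∀ i j : Fin n, |ρ i j - sqrtCorr ((i : ℤ) - (j : ℤ)).natAbs| ≤ K / (n * √n)) :
    |(1 / (n : ℝ)) * ∑ i, ∑ j, (72 * ρ i i * ρ j j * ρ i j ^ 2 + 24 * ρ i j ^ 4)
      - (1 / (n : ℝ)) * ∑ i : Fin n, ∑ j : Fin n, quarticLagVariance ((i : ℤ) - (j : ℤ)).natAbs|
      ≤ 384 * (1 + K) ^ 3 * K / √n := by
  have hn0 : (0 : ℝ) < n := by exact_mod_cast hn
  have hM : 1 ≤ 1 + K := by linarith
  rw [← mul_sub, ← Finset.sum_sub_distrib, abs_mul, abs_of_pos (by positivity : 0 < 1 / (n : ℝ))]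
  simp_rw [← Finset.sum_sub_distrib]
  calc _ ≤ (1 / (n : ℝ)) * ∑ _i : Fin n, ∑ _j : Fin n, 384 * (1 + K) ^ 3 * (K / (n * √n)) := by
        gcongr
        refine (Finset.abs_sum_le_sum_abs _ _).trans (Finset.sum_le_sum fun i _ => ?_)
        refine (Finset.abs_sum_le_sum_abs _ _).trans (Finset.sum_le_sum fun j _ => ?_)
        exact abs_quartic_coeff_sub_le hM (abs_cov_le hn hK h j j) (abs_cov_le hn hK h i j)
          ((abs_sqrtCorr_le_one _).trans hM) (abs_var_sub_one_le h i)
          (abs_var_sub_one_le h j) (h i j)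
    _ = _ := by
        simp only [Finset.sum_const, Finset.card_univ, Fintype.card_fin, nsmul_eq_mul]
        field_simp

/-- The bias of the normalized fourth-power functional. -/
lemma abs_bias_le (hn : 0 < n) (hK : 0 ≤ K)
    (h : ∀ i j : Fin n, |ρ i j - sqrtCorr ((i : ℤ) - (j : ℤ)).natAbs| ≤ K / (n * √n)) :
    |1 / √n * ∑ i, (3 * ρ i i ^ 2 - 3)| ≤ 6 * (1 + K) * K / n := by
  have hn0 : (0 : ℝ) < n := by exact_mod_cast hn
  have hM : 1 ≤ 1 + K := by linarith
  rw [abs_mul, abs_of_pos (by positivity : 0 < 1 / √(n : ℝ))]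
  calc _ ≤ 1 / √(n : ℝ) * ∑ _i : Fin n, 3 * (2 * (1 + K) * (K / (n * √n))) := by
        gcongr
        refine (Finset.abs_sum_le_sum_abs _ _).trans (Finset.sum_le_sum fun i _ => ?_)
        rw [show 3 * ρ i i ^ 2 - 3 = 3 * (ρ i i ^ 2 - 1 ^ 2) by ring, abs_mul,
          abs_of_pos (by norm_num : (0 : ℝ) < 3)]
        gcongr
        exact abs_sq_sub_sq_le (abs_cov_le hn hK h i i) (by simpa) (abs_var_sub_one_le h i)
    _ = _ := by
        have hs : √(n : ℝ) ^ 2 = n := Real.sq_sqrt hn0.le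
        simp only [Finset.sum_const, Finset.card_univ, Fintype.card_fin, nsmul_eq_mul]
        field_simp
        rw [hs]
        ring

end Perturbation

section CentralLimit

variable {Ω : Type*} [MeasurableSpace Ω] {P : Measure Ω}

lemma IsCenteredGaussianFamily.aemeasurable_quartic {n : ℕ} {X : Fin n → Ω → ℝ}
    {ρ : Fin n → Fin n → ℝ} (h : IsCenteredGaussianFamily P X ρ) (s : ℝ) :
    AEMeasurable (fun ω => IsCenteredGaussianFamily.quartic s ρ fun i => X i ω) P := by
  have := fun i => (h.gauss.eval i).aemeasurable
  unfold IsCenteredGaussianFamily.quartic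
  fun_prop

/-- Central limit theorem for the fourth variation of a triangular array of Gaussian variables
whose covariances are close to `sqrtCorr`. -/
lemma tendstoInDistribution_quartic [IsProbabilityMeasure P]
    {X : ∀ n : ℕ, Fin (n + 1) → Ω → ℝ} {ρ : ∀ n : ℕ, Fin (n + 1) → Fin (n + 1) → ℝ}
    (hX : ∀ n, IsCenteredGaussianFamily P (X n) (ρ n)) {K : ℝ} (hK : 0 ≤ K)
    (hρ : ∀ n, ∀ i j : Fin (n + 1), |ρ n i j - sqrtCorr ((i : ℤ) - (j : ℤ)).natAbs|
      ≤ K / ((n + 1 : ℕ) * √(n + 1 : ℕ))) :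
    TendstoInDistribution (fun n ω => IsCenteredGaussianFamily.quartic (1 / √(n + 1 : ℕ)) (ρ n)
      fun i => X n i ω) atTop (fun z : ℝ => z) (fun _ => P)
      (gaussianReal 0 quarticVariance.toNNReal) := by
  refine ⟨fun n => (hX n).aemeasurable_quartic _, by fun_prop, ?_⟩
  refine ProbabilityMeasure.tendsto_iff_tendsto_charFun.2 fun l => ?_
  simp only [ProbabilityMeasure.coe_mk, Measure.map_id']
  rw [charFun_gaussianReal]
  obtain ⟨K', hK', H⟩ := IsCenteredGaussianFamily.exists_norm_charFun_quartic_sub_le P (2 + K)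
    (by positivity)
  set W : ℕ → ℝ := fun n => (1 / ((n + 1 : ℕ) : ℝ)) * ∑ i, ∑ j,
    (72 * ρ n i i * ρ n j j * ρ n i j ^ 2 + 24 * ρ n i j ^ 4) with hW
  have hinv : Tendsto (fun n : ℕ => ((n + 1 : ℕ) : ℝ)) atTop atTop :=
    tendsto_natCast_atTop_atTop.comp (tendsto_add_atTop_nat 1)
  have hWlim : Tendsto W atTop (𝓝 quarticVariance) := by
    have h1 := (tendsto_inv_mul_sum_sum_natAbs_sub summable_quarticLagVariance_succ).comp
      (tendsto_add_atTop_nat 1)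
    refine h1.congr_dist (squeeze_zero (fun _ => dist_nonneg) (fun n => ?_)
      (tendsto_const_nhds (x := 384 * (1 + K) ^ 3 * K).div_atTop
        (Real.tendsto_sqrt_atTop.comp hinv)))
    rw [dist_comm, Real.dist_eq]
    exact abs_sum_quartic_coeff_sub_le n.succ_pos hK (hρ n)
  have hlim : Tendsto (fun n => Complex.exp (-(l ^ 2 * W n / 2) : ℝ)) atTop
      (𝓝 (Complex.exp (l * (0 : ℝ) * Complex.I
        - (quarticVariance.toNNReal : ℝ) * l ^ 2 / 2))) := by
    have e : (l * (0 : ℝ) * Complex.I - (quarticVariance.toNNReal : ℝ) * l ^ 2 / 2 : ℂ)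
        = ((-(l ^ 2 * quarticVariance / 2) : ℝ) : ℂ) := by
      rw [Real.coe_toNNReal _ quarticVariance_pos.le]
      push_cast
      ring
    rw [e]
    exact (Complex.continuous_exp.tendsto _).comp ((Complex.continuous_ofReal.tendsto _).comp
      ((hWlim.const_mul (l ^ 2)).div_const 2).neg)
  refine hlim.congr_dist (squeeze_zero (fun _ => dist_nonneg) (fun n => ?_)
    (g := fun n : ℕ => l ^ 2 * √(K' / ((n + 1 : ℕ) : ℝ))) ?_)
  · rw [dist_comm, dist_eq_norm, charFun_apply_real, integral_map ((hX n).aemeasurable_quartic _)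
      (by fun_prop)]
    have h1 := H (n + 1) (X n) (ρ n) (hX n) (sum_abs_cov_le n.succ_pos hK (hρ n)) n.succ_pos l
    simpa [oscIntegral, hW] using h1
  · have h2 := ((tendsto_const_nhds (x := K').div_atTop hinv).sqrt).const_mul (l ^ 2)
    simpa using h2

end CentralLimit

section DeltaMethod

variable {Ω : Type*} [MeasurableSpace Ω] {P : Measure Ω} [IsProbabilityMeasure P]

/-- Weak convergence is insensitive to a modification on events of vanishing probability. -/
lemma tendsto_integral_of_abs_sub_le {ν : Measure ℝ} [IsProbabilityMeasure ν]
    {F G D : ℕ → Ω → ℝ} {L : ℝ}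
    (hF : ∀ n, AEMeasurable (F n) P) (hG : ∀ n, AEMeasurable (G n) P)
    (hD : TendstoInDistribution D atTop (fun _ : ℝ => (0 : ℝ)) (fun _ => P) ν)
    (hFG : ∀ n ω, |D n ω| < 1 → F n ω = G n ω) (f : BoundedContinuousFunction ℝ ℝ)
    (hlim : Tendsto (fun n => ∫ ω, f (G n ω) ∂P) atTop (𝓝 L)) :
    Tendsto (fun n => ∫ ω, f (F n ω) ∂P) atTop (𝓝 L) := by
  let g : BoundedContinuousFunction ℝ ℝ := BoundedContinuousFunction.ofNormedAddCommGroup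
    (fun x => min 1 |x|) (by fun_prop) 1 fun x => by
      rw [Real.norm_eq_abs, abs_of_nonneg (le_min zero_le_one (abs_nonneg x))]
      exact min_le_left _ _
  have hg := (ProbabilityMeasure.tendsto_iff_forall_integral_tendsto.1 hD.tendsto) g
  simp only [ProbabilityMeasure.coe_mk] at hg
  rw [integral_map hD.aemeasurable_limit (by fun_prop)] at hg
  simp_rw [integral_map (hD.forall_aemeasurable _) (g.continuous.aestronglyMeasurable)] at hg
  simp only [g, BoundedContinuousFunction.coe_ofNormedAddCommGroup, abs_zero, integral_const,
    min_eq_right zero_le_one, smul_zero] at hg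
  refine hlim.congr_dist (squeeze_zero (fun _ => dist_nonneg) (fun n => ?_)
    (by simpa using hg.const_mul (2 * ‖f‖)))
  have hbound : ∀ {Y : Ω → ℝ}, AEMeasurable Y P → Integrable (fun ω => f (Y ω)) P := fun hY =>
    Integrable.of_bound (f.continuous.comp_aestronglyMeasurable hY.aestronglyMeasurable) ‖f‖
      (ae_of_all _ fun ω => f.norm_coe_le_norm _)
  have hgi : Integrable (fun ω => min 1 |D n ω|) P :=
    Integrable.of_bound (g.continuous.comp_aestronglyMeasurable
      (hD.forall_aemeasurable n).aestronglyMeasurable) ‖g‖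
      (ae_of_all _ fun ω => g.norm_coe_le_norm _)
  rw [dist_eq_norm, ← integral_sub (hbound (hG n)) (hbound (hF n)), ← integral_const_mul]
  refine norm_integral_le_of_norm_le (hgi.const_mul _) (ae_of_all _ fun ω => ?_)
  by_cases h : |D n ω| < 1
  · rw [hFG n ω h]
    simp only [sub_self, norm_zero]
    positivity
  · rw [min_eq_left (not_lt.1 h), mul_one, two_mul]
    exact (norm_sub_le _ _).trans (add_le_add (f.norm_coe_le_norm _) (f.norm_coe_le_norm _))

/-- Delta method for the reciprocal of an asymptotically normal statistic. -/
lemma tendsto_integral_reciprocal {F : ℕ → Ω → ℝ} {V : ℝ} (hV : 0 ≤ V)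
    (hF : TendstoInDistribution F atTop (fun z : ℝ => z) (fun _ => P) (gaussianReal 0 V.toNNReal))
    {b N : ℕ → ℝ} (hb : Tendsto b atTop (𝓝 0)) (hN0 : ∀ n, 0 < N n) (hN : Tendsto N atTop atTop)
    (θ : ℝ) (f : BoundedContinuousFunction ℝ ℝ) :
    Tendsto (fun n => ∫ ω, f (√(N n) *
        (3 * θ * N n / (3 * N n + √(N n) * (F n ω + b n)) - θ)) ∂P) atTop
      (𝓝 (∫ y, f y ∂(gaussianReal 0 (θ ^ 2 / 9 * V).toNNReal))) := by
  have hFm := hF.forall_aemeasurable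
  set s : ℕ → ℝ := fun n => 1 / √(N n) with hs
  have hslim : Tendsto s atTop (𝓝 0) :=
    (tendsto_const_nhds (x := (1 : ℝ))).div_atTop (Real.tendsto_sqrt_atTop.comp hN)
  have hbs : TendstoInMeasure P (fun n (_ : Ω) => (b n, s n)) atTop fun _ => ((0 : ℝ), (0 : ℝ)) :=
    tendstoInMeasure_of_tendsto_ae (fun n => aestronglyMeasurable_const)
      (ae_of_all _ fun _ => hb.prodMk_nhds hslim)
  have hD := hF.continuous_comp_prodMk_of_tendstoInMeasure_const
    (g := fun p : ℝ × (ℝ × ℝ) => (p.1 + p.2.1) * p.2.2) (by fun_prop) hbs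
    fun n => aemeasurable_const
  have hG := hF.continuous_comp_prodMk_of_tendstoInMeasure_const
    (g := fun p : ℝ × (ℝ × ℝ) => -θ * (p.1 + p.2.1) / max (3 + (p.1 + p.2.1) * p.2.2) 1)
    (Continuous.div (by fun_prop) (by fun_prop) fun p => (lt_max_of_lt_right one_pos).ne') hbs
    fun n => aemeasurable_const
  simp only [mul_zero] at hD
  refine tendsto_integral_of_abs_sub_le (fun n => ?_) hG.forall_aemeasurable hD
    (fun n ω h => ?_) f ?_
  · have := hFm n
    fun_prop
  · have hn := hN0 n
    have hsn : 0 < √(N n) := Real.sqrt_pos.2 hn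
    have h1 := (abs_lt.1 h).1
    simp only [hs] at h1 ⊢
    set Y := F n ω + b n
    have h2 : 0 < 3 + Y * (1 / √(N n)) := by linarith
    rw [max_eq_left (by linarith)]
    have e : 3 * N n + √(N n) * Y = N n * (3 + Y * (1 / √(N n))) := by
      have hsqrt : N n * (1 / √(N n)) = √(N n) := by rw [mul_one_div, Real.div_sqrt]
      linear_combination -Y * hsqrt
    rw [e, mul_comm (3 * θ), mul_div_mul_left _ _ hn.ne', div_sub' h2.ne', ← mul_div_assoc]
    congr 1
    field_simp
    ring
  · have hG' := (ProbabilityMeasure.tendsto_iff_forall_integral_tendsto.1 hG.tendsto) f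
    simp only [ProbabilityMeasure.coe_mk] at hG'
    simp_rw [integral_map (hG.forall_aemeasurable _) (f.continuous.aestronglyMeasurable)] at hG'
    convert hG' using 2
    have e : (fun z : ℝ => -θ * (z + 0) / max (3 + (z + 0) * 0) 1) = fun z => -θ / 3 * z := by
      ext z
      norm_num
      ring
    rw [e, gaussianReal_map_const_mul, mul_zero]
    congr 2
    ext
    rw [NNReal.coe_mul, Real.coe_toNNReal _ hV, Real.coe_toNNReal _ (by positivity)]
    simp only [NNReal.coe_mk]
    ring

end DeltaMethod

/-- Asymptotic normality, with rate `√n`, of the drift estimator `θ̂_{n,x}` built from the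
temporal fourth variation of the stochastic heat equation observed at a fixed spatial point
`x ∈ (0,π)` on the uniform time grid of `[c,d]` (weak convergence tested against bounded
continuous functions). -/
theorem stmt16 {Ω : Type*} [MeasurableSpace Ω] (P : Measure Ω) [IsProbabilityMeasure P]
    (θ σ x c d : ℝ) (hθ : 0 < θ) (hσ : 0 < σ) (hx : x ∈ Set.Ioo 0 π)
    (hc : 0 < c) (hcd : c < d)
    (u : ℝ → Ω → ℝ)
    (hu : IsCenteredGaussianField P u (Set.Icc c d) (heatCovTime θ σ x)) :
    ∃ V : ℝ, 0 < V ∧ ∀ f : BoundedContinuousFunction ℝ ℝ,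
      Tendsto (fun (n : ℕ) => ∫ ω,
          f (Real.sqrt (n : ℝ) *
            (3 * (d - c) * σ ^ 4 /
              (π * ∑ i ∈ Finset.range n,
                (u (c + (d - c) * ((i : ℝ) + 1) / (n : ℝ)) ω
                  - u (c + (d - c) * (i : ℝ) / (n : ℝ)) ω) ^ 4) - θ)) ∂P)
        atTop (nhds (∫ y, f y ∂(gaussianReal 0 V.toNNReal))) := by
  obtain ⟨K, hK, hinc⟩ := exists_normalized_increments hθ hσ hx hc hcd hu
  choose a ρ hfam ha hρ using fun n : ℕ => hinc (n + 1) n.succ_pos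
  have hN : Tendsto (fun n : ℕ => ((n + 1 : ℕ) : ℝ)) atTop atTop :=
    tendsto_natCast_atTop_atTop.comp (tendsto_add_atTop_nat 1)
  have hb : Tendsto (fun n : ℕ => 1 / √((n + 1 : ℕ) : ℝ) * ∑ i, (3 * ρ n i i ^ 2 - 3)) atTop
      (𝓝 0) :=
    squeeze_zero_norm (fun n => abs_bias_le n.succ_pos hK (hρ n))
      ((tendsto_const_nhds (x := 6 * (1 + K) * K)).div_atTop hN)
  have hV := quarticVariance_pos
  refine ⟨θ ^ 2 / 9 * quarticVariance, by positivity, fun f => ?_⟩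
  rw [← tendsto_add_atTop_iff_nat 1]
  refine (tendsto_integral_reciprocal hV.le (tendstoInDistribution_quartic hfam hK hρ) hb
    (fun n => by positivity) hN θ f).congr fun n => ?_
  congr 1 with ω
  congr 3
  have hN0 : (0 : ℝ) < (n + 1 : ℕ) := by positivity
  have hdc : 0 < d - c := sub_pos.2 hcd
  rw [Finset.sum_range]
  set S := ∑ i : Fin (n + 1), (u (c + (d - c) * ((i : ℝ) + 1) / (n + 1 : ℕ)) ω
    - u (c + (d - c) * (i : ℝ) / (n + 1 : ℕ)) ω) ^ 4 with hS
  have e : 3 * ((n + 1 : ℕ) : ℝ) + √(n + 1 : ℕ) *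
      (IsCenteredGaussianFamily.quartic (1 / √(n + 1 : ℕ)) (ρ n) (fun i =>
        a n * (u (c + (d - c) * ((i : ℝ) + 1) / (n + 1 : ℕ)) ω
          - u (c + (d - c) * (i : ℝ) / (n + 1 : ℕ)) ω))
        + 1 / √((n + 1 : ℕ) : ℝ) * ∑ i, (3 * ρ n i i ^ 2 - 3)) = a n ^ 4 * S := by
    have hsn : 0 < √((n + 1 : ℕ) : ℝ) := Real.sqrt_pos.2 hN0
    rw [IsCenteredGaussianFamily.quartic, ← mul_add, ← Finset.sum_add_distrib, ← mul_assoc,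
      mul_one_div_cancel hsn.ne', one_mul, hS, Finset.mul_sum]
    have h3 : 3 * ((n + 1 : ℕ) : ℝ) = ∑ _i : Fin (n + 1), 3 := by
      rw [Finset.sum_const, Finset.card_univ, Fintype.card_fin, nsmul_eq_mul, mul_comm]
    rw [h3, ← Finset.sum_add_distrib]
    exact Finset.sum_congr rfl fun i _ => by ring
  rw [e, ha]
  field_simp
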